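/- arXiv:1805.03741 — 5 statements merged into one kernel-verified Lean document; each statement's English description precedes it below -/
import Mathlib

section
/- For all positive integers s_A, t_A, s_D, t_B and Δ there exists a constant c, depending only on s_A, t_A, s_D, t_B and Δ, such that for every n ≥ 1, all integer matrices A (s_A×t_A), B (s_A×t_B), D (s_D×t_A) with entries of absolute value at most Δ, and every element g of the Graver basis G(H_0) of the 3-block n-fold matrix H_0 built from A, B, D, one has ‖g‖_∞ ≤ c·n^{t_A²+1}. -/
/-- `x ⊑ y`: `|x i| ≤ |y i|` and `x i · y i ≥ 0` for every coordinate `i`. -/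
def conformal {m : Type*} (x y : m → ℤ) : Prop :=
  ∀ i, |x i| ≤ |y i| ∧ 0 ≤ x i * y i

/-- The Graver basis of an integer matrix `M`: the `⊑`-minimal elements of
`{x : M x = 0, x ≠ 0}`. -/
def graverBasis {R C : Type*} [Fintype C] (M : Matrix R C ℤ) : Set (C → ℤ) :=
  {g | M.mulVec g = 0 ∧ g ≠ 0 ∧
    ∀ z : C → ℤ, M.mulVec z = 0 → z ≠ 0 → conformal z g → z = g}

/-- The 3-block n-fold matrix built from `A, B, D`. -/
def threeBlock (n sA tA sD tB : ℕ)
    (A : Matrix (Fin sA) (Fin tA) ℤ) (B : Matrix (Fin sA) (Fin tB) ℤ)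
    (D : Matrix (Fin sD) (Fin tA) ℤ) :
    Matrix (Fin sD ⊕ Fin n × Fin sA) (Fin tB ⊕ Fin n × Fin tA) ℤ :=
  Matrix.of fun r c =>
    match r, c with
    | Sum.inl _, Sum.inl _ => 0
    | Sum.inl i, Sum.inr (_, j) => D i j
    | Sum.inr (_, i), Sum.inl j => B i j
    | Sum.inr (k, i), Sum.inr (l, j) => if k = l then A i j else 0

namespace TB

theorem conf_iff (a b : ℤ) : (|a| ≤ |b| ∧ 0 ≤ a * b) ↔ ((0 ≤ a ∧ a ≤ b) ∨ (b ≤ a ∧ a ≤ 0)) := by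
  constructor
  · rintro ⟨h1, h2⟩
    rcases mul_nonneg_iff.1 h2 with ⟨ha, hb⟩ | ⟨ha, hb⟩
    · left; rw [abs_of_nonneg ha, abs_of_nonneg hb] at h1; exact ⟨ha, h1⟩
    · right; rw [abs_of_nonpos ha, abs_of_nonpos hb] at h1; exact ⟨by omega, ha⟩
  · rintro (⟨h1, h2⟩ | ⟨h1, h2⟩)
    · rw [abs_of_nonneg h1, abs_of_nonneg (h1.trans h2)]
      exact ⟨h2, mul_nonneg h1 (h1.trans h2)⟩
    · rw [abs_of_nonpos h2, abs_of_nonpos (h1.trans h2)]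
      exact ⟨by omega, mul_nonneg_of_nonpos_of_nonpos h2 (h1.trans h2)⟩

theorem conf_iff' {C : Type*} (x y : C → ℤ) :
    conformal x y ↔ ∀ i, ((0 ≤ x i ∧ x i ≤ y i) ∨ (y i ≤ x i ∧ x i ≤ 0)) :=
  forall_congr' fun _ => conf_iff _ _

theorem conf_refl {C : Type*} (x : C → ℤ) : conformal x x := by
  rw [conf_iff']; intro i; omega

theorem conf_trans {C : Type*} {x y z : C → ℤ} (h1 : conformal x y) (h2 : conformal y z) :
    conformal x z := by
  rw [conf_iff'] at *; intro i; have := h1 i; have := h2 i; omega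

theorem conf_sub {C : Type*} {x y : C → ℤ} (h1 : conformal x y) :
    conformal (y - x) y := by
  rw [conf_iff'] at *; intro i; have := h1 i; simp only [Pi.sub_apply]; omega

theorem antichain_finite {C : Type*} [Fintype C] (S : Set (C → ℤ))
    (h : ∀ x ∈ S, ∀ y ∈ S, conformal x y → x = y) : S.Finite := by
  let f : (C → ℤ) → (C ⊕ C → ℕ) := fun x => Sum.elim (fun c => (x c).toNat) (fun c => (-x c).toNat)
  have key : ∀ x y, f x ≤ f y → conformal x y := by
    intro x y hxy
    rw [conf_iff']
    intro i
    have h1 := hxy (Sum.inl i)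
    have h2 := hxy (Sum.inr i)
    simp only [f, Sum.elim_inl, Sum.elim_inr] at h1 h2
    omega
  have inj : Function.Injective f := by
    intro x y hxy
    funext i
    have h1 := congrFun hxy (Sum.inl i)
    have h2 := congrFun hxy (Sum.inr i)
    simp only [f, Sum.elim_inl, Sum.elim_inr] at h1 h2
    omega
  have : (f '' S).Finite := by
    apply WellQuasiOrderedLE.finite_of_isAntichain
    rintro _ ⟨x, hx, rfl⟩ _ ⟨y, hy, rfl⟩ hne hle
    exact hne (congrArg f (h x hx y hy (key _ _ hle)))
  exact this.of_finite_image inj.injOn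

/-- atoms of a lattice -/
def atoms {C : Type*} (K : AddSubgroup (C → ℤ)) : Set (C → ℤ) :=
  {g | g ∈ K ∧ g ≠ 0 ∧ ∀ z ∈ K, z ≠ 0 → conformal z g → z = g}

theorem atoms_finite {C : Type*} [Fintype C] (K : AddSubgroup (C → ℤ)) : (atoms K).Finite := by
  apply antichain_finite
  intro x hx y hy hxy
  exact hy.2.2 x hx.1 hx.2.1 hxy

theorem norm_lt {C : Type*} [Fintype C] {x y : C → ℤ} (h : conformal x y) (hne : x ≠ y) :
    ∑ i, (x i).natAbs < ∑ i, (y i).natAbs := by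
  rw [conf_iff'] at h
  obtain ⟨i, hi⟩ := Function.ne_iff.1 hne
  apply Finset.sum_lt_sum
  · intro j _; have := h j; omega
  · refine ⟨i, Finset.mem_univ _, ?_⟩
    have := h i; omega

theorem exists_atom {C : Type*} [Fintype C] (K : AddSubgroup (C → ℤ)) :
    ∀ z ∈ K, z ≠ 0 → ∃ g ∈ atoms K, conformal g z := by
  intro z
  induction hN : (∑ i, (z i).natAbs) using Nat.strong_induction_on generalizing z with
  | _ N ih =>
    intro hz hz0
    by_cases hA : z ∈ atoms K
    · exact ⟨z, hA, conf_refl z⟩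
    · simp only [atoms, Set.mem_ofPred_eq, not_and, not_forall] at hA
      obtain ⟨w, hw, hw0, hwz, hne⟩ := hA hz hz0
      obtain ⟨g, hg, hgw⟩ := ih _ (hN ▸ norm_lt hwz hne) w rfl hw hw0
      exact ⟨g, hg, conf_trans hgw hwz⟩

theorem decomp {C : Type*} [Fintype C] (K : AddSubgroup (C → ℤ)) (S : Set (C → ℤ))
    (hS : ∀ z ∈ K, z ≠ 0 → ∃ h ∈ S, h ∈ K ∧ h ≠ 0 ∧ conformal h z) :
    ∀ z ∈ K, ∃ l : List (C → ℤ), l.sum = z ∧ ∀ h ∈ l, h ∈ S ∧ h ∈ K ∧ h ≠ 0 ∧ conformal h z := by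
  intro z
  induction hN : (∑ i, (z i).natAbs) using Nat.strong_induction_on generalizing z with
  | _ N ih =>
    intro hz
    by_cases hz0 : z = 0
    · exact ⟨[], by simp [hz0], by simp⟩
    · obtain ⟨h, hhS, hhK, hh0, hhz⟩ := hS z hz hz0
      have hc := conf_sub hhz
      obtain ⟨l, hl, hl2⟩ := ih _ (hN ▸ norm_lt hc (by simpa using hh0)) (z - h) rfl
        (K.sub_mem hz hhK)
      refine ⟨h :: l, by simp [hl], ?_⟩
      intro g hg
      rcases List.mem_cons.1 hg with rfl | hg
      · exact ⟨hhS, hhK, hh0, hhz⟩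
      · obtain ⟨a, b, c, d⟩ := hl2 g hg
        exact ⟨a, b, c, conf_trans d hc⟩

theorem list_sum_apply {C : Type*} (l : List (C → ℤ)) (c : C) :
    l.sum c = (l.map (fun h => h c)).sum := by
  induction l with
  | nil => simp
  | cons a l ih => simp [ih]

theorem abs_list_sum {C : Type*} (z : C → ℤ) (l : List (C → ℤ))
    (hl : ∀ h ∈ l, conformal h z) (c : C) :
    |l.sum c| = (l.map (fun h => |h c|)).sum := by
  rw [list_sum_apply]
  have h' : ∀ h ∈ l, ((0 ≤ h c ∧ h c ≤ z c) ∨ (z c ≤ h c ∧ h c ≤ 0)) :=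
    fun h hh => (conf_iff' _ _).1 (hl h hh) c
  rcases le_total 0 (z c) with hz | hz
  · have h1 : l.map (fun h => |h c|) = l.map (fun h => h c) := by
      apply List.map_congr_left
      intro h hh
      have := h' h hh
      exact abs_of_nonneg (by omega)
    rw [h1]
    apply abs_of_nonneg
    apply List.sum_nonneg
    intro x hx
    obtain ⟨h, hh, rfl⟩ := List.mem_map.1 hx
    have := h' h hh
    omega
  · have h1 : l.map (fun h => |h c|) = l.map (fun h => - (h c)) := by
      apply List.map_congr_left
      intro h hh
      have := h' h hh
      exact abs_of_nonpos (by omega)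
    have h2 : (l.map (fun h => - (h c))).sum = - (l.map (fun h => h c)).sum := by
      clear h1 h' hl
      induction l with
      | nil => simp
      | cons a l ih => simp [ih]; ring
    rw [h1, h2]
    apply abs_of_nonpos
    have : 0 ≤ (l.map (fun h => - (h c))).sum := by
      apply List.sum_nonneg
      intro x hx
      obtain ⟨h, hh, rfl⟩ := List.mem_map.1 hx
      have := h' h hh
      omega
    omega

/-- pigeonhole on a conformal decomposition -/
theorem share {C : Type*} [Fintype C] (K : AddSubgroup (C → ℤ)) :
    ∃ R : ℕ, ∀ z ∈ K, ∀ c, ∀ N : ℕ, (R : ℤ) * N < |z c| →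
      ∃ h ∈ K, h c ≠ 0 ∧ (∀ i, |h i| ≤ R) ∧ ∀ i, N * |h i| ≤ |z i| ∧ 0 ≤ h i * z i := by
  classical
  have hfin := atoms_finite K
  obtain ⟨K0, hK0⟩ : ∃ K0 : ℕ, ∀ g ∈ atoms K, ∀ i, |g i| ≤ K0 := by
    refine ⟨hfin.toFinset.sup (fun g => Finset.univ.sup fun i => (g i).natAbs), ?_⟩
    intro g hg i
    have h1 : (g i).natAbs ≤ Finset.univ.sup fun i => (g i).natAbs :=
      Finset.le_sup (f := fun i => (g i).natAbs) (Finset.mem_univ i)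
    have h2 := Finset.le_sup (f := fun g : C → ℤ => Finset.univ.sup fun i => (g i).natAbs)
      (hfin.mem_toFinset.2 hg)
    have := h1.trans h2
    rw [Int.abs_eq_natAbs]
    exact_mod_cast this
  refine ⟨hfin.toFinset.card * K0 + K0, ?_⟩
  intro z hz c N hlt
  obtain ⟨l, hl, hl2⟩ := decomp K (atoms K) (fun z hz hz0 => by
    obtain ⟨g, hg, hgz⟩ := exists_atom K z hz hz0
    exact ⟨g, hg, hg.1, hg.2.1, hgz⟩) z hz
  have hcount : ∀ i, |z i| = ∑ g ∈ l.toFinset, (l.count g : ℤ) * |g i| := by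
    intro i
    rw [← hl, abs_list_sum z l (fun h hh => (hl2 h hh).2.2.2) i, Finset.sum_list_map_count]
    simp
  have hsub : l.toFinset ⊆ hfin.toFinset := by
    intro g hg
    exact hfin.mem_toFinset.2 (hl2 g (List.mem_toFinset.1 hg)).1
  obtain ⟨h, hh, hhc, hhN⟩ : ∃ h ∈ l.toFinset, h c ≠ 0 ∧ N ≤ l.count h := by
    by_contra hcon
    push Not at hcon
    have : |z c| ≤ ∑ g ∈ l.toFinset, ((N : ℤ) * K0) := by
      rw [hcount]
      apply Finset.sum_le_sum
      intro g hg
      by_cases hgc : g c = 0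
      · simp only [hgc, abs_zero, mul_zero]; positivity
      · have h1 := hcon g hg hgc
        have h2 := hK0 g (hfin.mem_toFinset.1 (hsub hg)) c
        have h3 : (l.count g : ℤ) ≤ N := by exact_mod_cast h1.le
        exact mul_le_mul h3 h2 (abs_nonneg _) (by positivity)
    rw [Finset.sum_const, nsmul_eq_mul] at this
    have hcard : (l.toFinset.card : ℤ) ≤ hfin.toFinset.card := by
      exact_mod_cast Finset.card_le_card hsub
    have h4 : (l.toFinset.card : ℤ) * (N * K0) ≤ hfin.toFinset.card * (N * K0) :=
      mul_le_mul_of_nonneg_right hcard (by positivity)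
    push_cast at hlt
    have h5 : (0:ℤ) ≤ K0 * N := by positivity
    nlinarith
  obtain ⟨ha, hK, h0, hconf⟩ := hl2 h (List.mem_toFinset.1 hh)
  refine ⟨h, hK, hhc, ?_, ?_⟩
  · intro i
    have h1 := hK0 h ha i
    push_cast
    have : (0:ℤ) ≤ hfin.toFinset.card * K0 := by positivity
    linarith
  · intro i
    refine ⟨?_, (hconf i).2⟩
    rw [hcount i]
    have h1 : (l.count h : ℤ) * |h i| ≤ ∑ g ∈ l.toFinset, (l.count g : ℤ) * |g i| :=
      Finset.single_le_sum (f := fun g => (l.count g : ℤ) * |g i|)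
        (fun g _ => by positivity) hh
    refine le_trans ?_ h1
    apply mul_le_mul_of_nonneg_right _ (abs_nonneg _)
    exact_mod_cast hhN

/-- support reduction -/
theorem supp_red {s t : ℕ} (A : Matrix (Fin s) (Fin t) ℚ) : ∀ (m : ℕ) (y : Fin t → ℚ),
    (Finset.univ.filter fun j => y j ≠ 0).card ≤ m →
    ∃ y' : Fin t → ℚ, A.mulVec y' = A.mulVec y ∧
      (∀ j, 0 ≤ y' j * y j ∧ |y' j| ≤ 2 ^ m * |y j|) ∧
      ∀ k : Fin t → ℚ, (∀ j, y' j = 0 → k j = 0) → A.mulVec k = 0 → k = 0 := by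
  intro m
  induction m with
  | zero =>
    intro y hy
    have h0 : ∀ j, y j = 0 := by
      intro j
      by_contra hj
      have : j ∈ (Finset.univ.filter fun j => y j ≠ 0) := by simp [hj]
      rw [Finset.card_eq_zero.1 (Nat.le_zero.1 hy)] at this
      simp at this
    refine ⟨y, rfl, fun j => ⟨mul_self_nonneg _, by simp⟩, fun k hk _ => funext fun j => hk j (h0 j)⟩
  | succ m ih =>
    intro y hy
    by_cases hcase : ∀ k : Fin t → ℚ, (∀ j, y j = 0 → k j = 0) → A.mulVec k = 0 → k = 0
    · refine ⟨y, rfl, fun j => ⟨mul_self_nonneg _, ?_⟩, hcase⟩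
      have : (1:ℚ) ≤ 2 ^ (m+1) := one_le_pow₀ (by norm_num)
      nlinarith [abs_nonneg (y j)]
    · push Not at hcase
      obtain ⟨k, hk, hAk, hk0⟩ := hcase
      obtain ⟨j0, hj0⟩ := Function.ne_iff.1 hk0
      obtain ⟨i, hi, hmin⟩ := Finset.exists_min_image (Finset.univ.filter fun j => k j ≠ 0)
        (fun j => |y j| / |k j|) ⟨j0, by simpa using hj0⟩
      have hki : k i ≠ 0 := by simpa using hi
      let τ := y i / k i
      have hτ : ∀ j, |τ * k j| ≤ |y j| := by
        intro j
        by_cases hj : k j = 0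
        · simp [hj]
        · have := hmin j (by simpa using hj)
          rw [le_div_iff₀ (abs_pos.2 hj)] at this
          simpa [τ, abs_mul, abs_div] using this
      let w : Fin t → ℚ := y - τ • k
      have hwj : ∀ j, w j = y j - τ * k j := fun j => by simp [w]
      have hwA : A.mulVec w = A.mulVec y := by
        simp [w, Matrix.mulVec_sub, Matrix.mulVec_smul, hAk]
      have hw1 : ∀ j, 0 ≤ w j * y j ∧ |w j| ≤ 2 * |y j| := by
        intro j
        rw [hwj]
        have h1 := hτ j
        constructor
        · have h2 : τ * k j * y j ≤ |y j| * |y j| := by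
            calc τ * k j * y j ≤ |τ * k j * y j| := le_abs_self _
              _ = |τ * k j| * |y j| := abs_mul _ _
              _ ≤ _ := mul_le_mul_of_nonneg_right h1 (abs_nonneg _)
          rw [abs_mul_abs_self] at h2
          linarith [sub_mul (y j) (τ * k j) (y j)]
        · have := abs_sub (y j) (τ * k j)
          linarith
      have hw0 : ∀ j, y j = 0 → w j = 0 := by
        intro j hj; rw [hwj, hj, hk j hj]; simp
      have hwi : w i = 0 := by
        rw [hwj]; simp only [τ]; field_simp; ring
      have hcard : (Finset.univ.filter fun j => w j ≠ 0).card ≤ m := by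
        have hlt : (Finset.univ.filter fun j => w j ≠ 0).card <
            (Finset.univ.filter fun j => y j ≠ 0).card := by
          apply Finset.card_lt_card
          refine (Finset.ssubset_iff_of_subset ?_).2 ⟨i, ?_, ?_⟩
          · intro j hj
            simp only [Finset.mem_filter, Finset.mem_univ, true_and] at hj ⊢
            exact fun h => hj (hw0 j h)
          · simp only [Finset.mem_filter, Finset.mem_univ, true_and]
            exact fun h => hki (hk i h)
          · simp [hwi]
        omega
      obtain ⟨y', h1, h2, h3⟩ := ih w hcard
      refine ⟨y', h1.trans hwA, fun j => ⟨?_, ?_⟩, h3⟩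
      · by_cases hwz : w j = 0
        · have := (h2 j).2
          rw [hwz] at this
          have h0 : y' j = 0 := by simpa using this
          simp [h0]
        · have a1 := (h2 j).1
          have a2 := (hw1 j).1
          have a3 : 0 < w j * w j := mul_self_pos.2 hwz
          have a4 : 0 ≤ (y' j * y j) * (w j * w j) := by
            have := mul_nonneg a1 a2
            nlinarith
          exact nonneg_of_mul_nonneg_left a4 a3
      · calc |y' j| ≤ 2 ^ m * |w j| := (h2 j).2
          _ ≤ 2 ^ m * (2 * |y j|) := mul_le_mul_of_nonneg_left (hw1 j).2 (by positivity)
          _ = _ := by ring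

def twoK (ι : Type*) {sA tA tB : ℕ} (A : Matrix (Fin sA) (Fin tA) ℤ)
    (B : Matrix (Fin sA) (Fin tB) ℤ) : AddSubgroup (Fin tB ⊕ ι × Fin tA → ℤ) where
  carrier := {z | ∀ i, B.mulVec (fun j => z (Sum.inl j)) + A.mulVec (fun j => z (Sum.inr (i, j))) = 0}
  zero_mem' := by
    intro i
    have h1 : (fun j : Fin tB => (0 : Fin tB ⊕ ι × Fin tA → ℤ) (Sum.inl j)) = 0 := rfl
    have h2 : (fun j : Fin tA => (0 : Fin tB ⊕ ι × Fin tA → ℤ) (Sum.inr (i, j))) = 0 := rfl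
    rw [h1, h2]; simp
  add_mem' := by
    intro a b ha hb i
    have h1 : (fun j : Fin tB => (a + b) (Sum.inl j)) =
      (fun j => a (Sum.inl j)) + (fun j => b (Sum.inl j)) := rfl
    have h2 : (fun j : Fin tA => (a + b) (Sum.inr (i, j))) =
      (fun j => a (Sum.inr (i, j))) + (fun j => b (Sum.inr (i, j))) := rfl
    rw [h1, h2, Matrix.mulVec_add, Matrix.mulVec_add]
    have := ha i
    have := hb i
    rw [add_add_add_comm, ha i, hb i, add_zero]
  neg_mem' := by
    intro a ha i
    have h1 : (fun j : Fin tB => (-a) (Sum.inl j)) = -(fun j => a (Sum.inl j)) := rfl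
    have h2 : (fun j : Fin tA => (-a) (Sum.inr (i, j))) = -(fun j => a (Sum.inr (i, j))) := rfl
    rw [h1, h2, Matrix.mulVec_neg, Matrix.mulVec_neg, ← neg_add, ha i, neg_zero]

theorem clear_den {C : Type*} [Fintype C] (q : C → ℚ) :
    ∃ (M : ℕ) (w : C → ℤ), 0 < M ∧ ∀ c, (w c : ℚ) = M * q c := by
  classical
  refine ⟨∏ c, (q c).den, fun c => (∏ d ∈ Finset.univ.erase c, ((q d).den : ℤ)) * (q c).num,
    Finset.prod_pos fun c _ => (q c).den_pos, ?_⟩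
  intro c
  rw [← Finset.mul_prod_erase Finset.univ (fun c => (q c).den) (Finset.mem_univ c)]
  push_cast
  have : ((q c).den : ℚ) * q c = (q c).num := Rat.den_mul_eq_num _
  linear_combination -(∏ d ∈ Finset.univ.erase c, ((q d).den : ℚ)) * this

theorem cast_mulVec {s t : ℕ} (A : Matrix (Fin s) (Fin t) ℤ) (v : Fin t → ℤ) (r : Fin s) :
    ((A.mulVec v r : ℤ) : ℚ) = (A.map (Int.cast : ℤ → ℚ)).mulVec (fun j => (v j : ℚ)) r := by
  simp [Matrix.mulVec, dotProduct]

theorem big_x {sA tA tB : ℕ} (A : Matrix (Fin sA) (Fin tA) ℤ)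
    (B : Matrix (Fin sA) (Fin tB) ℤ) : ∃ L : ℕ, ∀ (ι : Type) [Nonempty ι],
    ∀ z ∈ twoK ι A B, ∀ j0, (L : ℤ) < |z (Sum.inl j0)| →
      ∃ h ∈ twoK ι A B, h ≠ 0 ∧ conformal h z ∧ ∀ c, |h c| ≤ L := by
  classical
  obtain ⟨R, hR⟩ := share (twoK (Finset (Fin tA)) A B)
  refine ⟨R * 2 ^ tA, ?_⟩
  intro ι _ z hz j0 hbig
  let A' := A.map (Int.cast : ℤ → ℚ)
  let B' := B.map (Int.cast : ℤ → ℚ)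
  have hred := fun i : ι => supp_red A' tA (fun j => (z (Sum.inr (i, j)) : ℚ))
    ((Finset.card_le_univ _).trans (by simp))
  choose ys hA hs hu using hred
  let b : ι → Finset (Fin tA) := fun i => Finset.univ.filter fun j => ys i j ≠ 0
  let f := Function.invFun b
  have hf : ∀ i, b (f (b i)) = b i := fun i => Function.invFun_eq ⟨i, rfl⟩
  have hzQ : ∀ i, B'.mulVec (fun j => (z (Sum.inl j) : ℚ)) + A'.mulVec (ys i) = 0 := by
    intro i
    rw [hA i]
    funext r
    have := congrFun (hz i) r
    simp only [Pi.add_apply, Pi.zero_apply] at this ⊢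
    rw [← cast_mulVec, ← cast_mulVec]
    exact_mod_cast this
  have hyf : ∀ i, ys (f (b i)) = ys i := by
    intro i
    have h1 := hu i (ys (f (b i)) - ys i) (by
      intro j hj
      have : j ∉ b (f (b i)) := by rw [hf]; simp [b, hj]
      have h2 : ys (f (b i)) j = 0 := by simpa [b] using this
      simp [hj, h2]) (by
      rw [Matrix.mulVec_sub, sub_eq_zero]
      have := (hzQ (f (b i))).trans (hzQ i).symm
      exact add_left_cancel this)
    exact sub_eq_zero.1 h1
  let q : Fin tB ⊕ Finset (Fin tA) × Fin tA → ℚ :=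
    Sum.elim (fun j => (z (Sum.inl j) : ℚ)) (fun p => ys (f p.1) p.2)
  obtain ⟨M, w, hM, hw⟩ := clear_den q
  have hMQ : (0:ℚ) < M := by exact_mod_cast hM
  have hwK : w ∈ twoK (Finset (Fin tA)) A B := by
    intro i
    funext r
    have h1 : (fun j => (w (Sum.inl j) : ℚ)) = (M : ℚ) • (fun j => (z (Sum.inl j) : ℚ)) := by
      funext j; rw [hw]; simp [q]
    have h2 : (fun j => (w (Sum.inr (i, j)) : ℚ)) = (M : ℚ) • ys (f i) := by
      funext j; rw [hw]; simp [q]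
    have h3 := congrFun (hzQ (f i)) r
    have : ((B.mulVec (fun j => w (Sum.inl j)) r + A.mulVec (fun j => w (Sum.inr (i, j))) r : ℤ) : ℚ)
        = 0 := by
      push_cast
      rw [cast_mulVec, cast_mulVec, h1, h2, Matrix.mulVec_smul, Matrix.mulVec_smul]
      simp only [Pi.add_apply, Pi.zero_apply, Pi.smul_apply, smul_eq_mul] at h3 ⊢
      rw [← mul_add]
      simp only [A', B'] at h3
      rw [h3, mul_zero]
    simp only [Pi.add_apply, Pi.zero_apply]
    exact_mod_cast this
  obtain ⟨h, hhK, hh0, hhR, hhN⟩ := hR w hwK (Sum.inl j0) (M * 2 ^ tA) (by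
    have h1 : ((|w (Sum.inl j0)| : ℤ) : ℚ) = M * |(z (Sum.inl j0) : ℚ)| := by
      rw [Int.cast_abs, hw, abs_mul, abs_of_pos hMQ]; simp [q]
    have h2 : ((R * 2 ^ tA : ℕ) : ℚ) < |(z (Sum.inl j0) : ℚ)| := by exact_mod_cast hbig
    have h3 : ((R * (M * 2 ^ tA : ℕ) : ℤ) : ℚ) < ((|w (Sum.inl j0)| : ℤ) : ℚ) := by
      rw [h1]
      push_cast at h2 ⊢
      nlinarith
    exact_mod_cast h3)
  have hq : ∀ c, 2 ^ tA * |(h c : ℚ)| ≤ |q c| ∧ 0 ≤ (h c : ℚ) * q c := by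
    intro c
    obtain ⟨h1, h2⟩ := hhN c
    constructor
    · have h3 : (((M * 2 ^ tA : ℕ) : ℤ) * |h c| : ℚ) ≤ |(w c : ℚ)| := by exact_mod_cast h1
      rw [hw, abs_mul, abs_of_pos hMQ] at h3
      push_cast at h3
      rw [mul_assoc] at h3
      exact le_of_mul_le_mul_left h3 hMQ
    · have h3 : (0:ℚ) ≤ (h c : ℚ) * (w c : ℚ) := by exact_mod_cast h2
      rw [hw] at h3
      have : (0:ℚ) ≤ M * (h c * q c) := by linarith
      exact nonneg_of_mul_nonneg_right this hMQ
  have h2p : (1:ℚ) ≤ 2 ^ tA := one_le_pow₀ (by norm_num)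
  let H : Fin tB ⊕ ι × Fin tA → ℤ :=
    Sum.elim (fun j => h (Sum.inl j)) (fun p => h (Sum.inr (b p.1, p.2)))
  refine ⟨H, ?_, ?_, ?_, ?_⟩
  · intro i
    exact hhK (b i)
  · intro h0
    exact hh0 (congrFun h0 (Sum.inl j0))
  · rintro (j | ⟨i, j⟩)
    · have h1 := hq (Sum.inl j)
      simp only [q, Sum.elim_inl] at h1
      have e : H (Sum.inl j) = h (Sum.inl j) := rfl
      rw [e]
      constructor
      · have : |(h (Sum.inl j) : ℚ)| ≤ |(z (Sum.inl j) : ℚ)| := by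
          nlinarith [abs_nonneg (h (Sum.inl j) : ℚ)]
        exact_mod_cast this
      · exact_mod_cast h1.2
    · have h1 := hq (Sum.inr (b i, j))
      simp only [q, Sum.elim_inr] at h1
      rw [hyf i] at h1
      have e : H (Sum.inr (i, j)) = h (Sum.inr (b i, j)) := rfl
      rw [e]
      obtain ⟨h2, h3⟩ := hs i j
      have hp : (0:ℚ) < 2 ^ tA := by positivity
      have hle : |(h (Sum.inr (b i, j)) : ℚ)| ≤ |(z (Sum.inr (i, j)) : ℚ)| :=
        le_of_mul_le_mul_left (h1.1.trans h3) hp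
      constructor
      · exact_mod_cast hle
      · by_cases hy : ys i j = 0
        · have h4 := h1.1
          rw [hy] at h4
          have h5 : |(h (Sum.inr (b i, j)) : ℚ)| ≤ 0 := by
            simp only [abs_zero] at h4
            exact nonpos_of_mul_nonpos_right h4 hp
          have h6 : (h (Sum.inr (b i, j)) : ℚ) = 0 := abs_nonpos_iff.1 h5
          have h7 : h (Sum.inr (b i, j)) = 0 := by exact_mod_cast h6
          simp [h7]
        · have a3 : 0 < ys i j * ys i j := mul_self_pos.2 hy
          have a4 : 0 ≤ ((h (Sum.inr (b i, j)) : ℚ) * z (Sum.inr (i, j))) * (ys i j * ys i j) := by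
            have := mul_nonneg h1.2 h2
            nlinarith
          have := nonneg_of_mul_nonneg_left a4 a3
          exact_mod_cast this
  · have hR1 : ∀ c, |h c| ≤ ((R * 2 ^ tA : ℕ) : ℤ) := by
      intro c
      refine (hhR c).trans ?_
      exact_mod_cast Nat.le_mul_of_pos_right R (by positivity)
    rintro (j | ⟨i, j⟩)
    · exact hR1 _
    · exact hR1 _

theorem finite_bound {C : Type*} [Fintype C] (S : Set (C → ℤ)) (hfin : S.Finite) :
    ∃ K0 : ℕ, ∀ g ∈ S, ∀ i, |g i| ≤ K0 := by
  refine ⟨hfin.toFinset.sup (fun g => Finset.univ.sup fun i => (g i).natAbs), ?_⟩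
  intro g hg i
  have h1 : (g i).natAbs ≤ Finset.univ.sup fun i => (g i).natAbs :=
    Finset.le_sup (f := fun i => (g i).natAbs) (Finset.mem_univ i)
  have h2 := Finset.le_sup (f := fun g : C → ℤ => Finset.univ.sup fun i => (g i).natAbs)
    (hfin.mem_toFinset.2 hg)
  have := h1.trans h2
  rw [Int.abs_eq_natAbs]
  exact_mod_cast this

def kerK {s t : ℕ} (A : Matrix (Fin s) (Fin t) ℤ) : AddSubgroup (Fin t → ℤ) where
  carrier := {z | A.mulVec z = 0}
  zero_mem' := by simp
  add_mem' := by
    intro a b ha hb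
    show A.mulVec (a + b) = 0
    rw [Matrix.mulVec_add, show A.mulVec a = 0 from ha, show A.mulVec b = 0 from hb, add_zero]
  neg_mem' := by
    intro a ha
    show A.mulVec (-a) = 0
    rw [Matrix.mulVec_neg, show A.mulVec a = 0 from ha, neg_zero]

theorem small_x {sA tA tB : ℕ} (A : Matrix (Fin sA) (Fin tA) ℤ)
    (B : Matrix (Fin sA) (Fin tB) ℤ) (L : ℕ) :
    ∃ K : ℕ, ∀ (x : Fin tB → ℤ) (y : Fin tA → ℤ), (∀ j, |x j| ≤ L) → B.mulVec x + A.mulVec y = 0 →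
      (∀ k, A.mulVec k = 0 → conformal k y → k = 0) → ∀ j, |y j| ≤ K := by
  have hfin : Set.Finite (⋃ x ∈ Set.Icc (fun _ : Fin tB => (-(L:ℤ))) (fun _ => (L:ℤ)),
      {y : Fin tA → ℤ | B.mulVec x + A.mulVec y = 0 ∧
        (∀ k, A.mulVec k = 0 → conformal k y → k = 0)}) := by
    apply Set.Finite.biUnion (Set.finite_Icc _ _)
    intro x _
    apply antichain_finite
    rintro y ⟨hy1, hy2⟩ y' ⟨hy1', hy2'⟩ hc
    have := hy2' (y' - y) (by
      rw [Matrix.mulVec_sub, sub_eq_zero]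
      exact add_left_cancel (hy1'.trans hy1.symm)) (conf_sub hc)
    exact (sub_eq_zero.1 this).symm
  obtain ⟨K, hK⟩ := finite_bound _ hfin
  refine ⟨K, ?_⟩
  intro x y hx hxy hk j
  apply hK y
  simp only [Set.mem_iUnion]
  exact ⟨x, ⟨fun j => (abs_le.1 (hx j)).1, fun j => (abs_le.1 (hx j)).2⟩, hxy, hk⟩

theorem two_stage {sA tA tB : ℕ} (A : Matrix (Fin sA) (Fin tA) ℤ)
    (B : Matrix (Fin sA) (Fin tB) ℤ) : ∃ K : ℕ, ∀ (ι : Type) [Nonempty ι],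
    ∀ z ∈ twoK ι A B, z ≠ 0 →
      ∃ h ∈ twoK ι A B, h ≠ 0 ∧ conformal h z ∧ ∀ c, |h c| ≤ K := by
  classical
  obtain ⟨L, hL⟩ := big_x A B
  obtain ⟨K1, hK1⟩ := small_x A B L
  obtain ⟨K2, hK2⟩ := finite_bound _ (atoms_finite (kerK A))
  refine ⟨L + K1 + K2, ?_⟩
  intro ι _ z hz hz0
  by_cases hx : ∃ j0, (L : ℤ) < |z (Sum.inl j0)|
  · obtain ⟨j0, hj0⟩ := hx
    obtain ⟨h, h1, h2, h3, h4⟩ := hL ι z hz j0 hj0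
    refine ⟨h, h1, h2, h3, fun c => (h4 c).trans ?_⟩
    push_cast; linarith
  push Not at hx
  by_cases hk : ∃ i, ∃ k, A.mulVec k = 0 ∧ conformal k (fun j => z (Sum.inr (i, j))) ∧ k ≠ 0
  · obtain ⟨i, k, hAk, hkc, hk0⟩ := hk
    obtain ⟨g, hg, hgk⟩ := exists_atom (kerK A) k hAk hk0
    let H : Fin tB ⊕ ι × Fin tA → ℤ :=
      Sum.elim (fun j => 0) (fun p => if p.1 = i then g p.2 else 0)
    refine ⟨H, ?_, ?_, ?_, ?_⟩
    · intro i'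
      have e1 : (fun j : Fin tB => H (Sum.inl j)) = 0 := rfl
      by_cases hi : i' = i
      · have e2 : (fun j : Fin tA => H (Sum.inr (i', j))) = g := by
          funext j; simp [H, hi]
        rw [e1, e2, show A.mulVec g = 0 from hg.1]; simp
      · have e2 : (fun j : Fin tA => H (Sum.inr (i', j))) = 0 := by
          funext j; simp [H, hi]
        rw [e1, e2]; simp
    · intro h0
      apply hg.2.1
      funext j
      have := congrFun h0 (Sum.inr (i, j))
      simpa [H] using this
    · rintro (j | ⟨i', j⟩)
      · simp [H]
      · by_cases hi : i' = i
        · have := conf_trans hgk hkc j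
          simpa [H, hi] using this
        · simp [H, hi]
    · rintro (j | ⟨i', j⟩)
      · simp only [H, Sum.elim_inl, abs_zero]; positivity
      · by_cases hi : i' = i
        · have := hK2 g hg j
          simp only [H, Sum.elim_inr, hi, if_true]
          push_cast; linarith
        · simp only [H, Sum.elim_inr, hi, if_false, abs_zero]; positivity
  · push Not at hk
    refine ⟨z, hz, hz0, conf_refl z, ?_⟩
    rintro (j | ⟨i, j⟩)
    · have := hx j
      push_cast; linarith
    · have := hK1 (fun j => z (Sum.inl j)) (fun j => z (Sum.inr (i, j))) hx (hz i) (hk i) j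
      push_cast; linarith

theorem two_stage_unif (sA tA tB Δ : ℕ) : ∃ K : ℕ, ∀ (A : Matrix (Fin sA) (Fin tA) ℤ)
    (B : Matrix (Fin sA) (Fin tB) ℤ), (∀ i j, |A i j| ≤ (Δ : ℤ)) → (∀ i j, |B i j| ≤ (Δ : ℤ)) →
    ∀ (ι : Type) [Nonempty ι],
    ∀ z ∈ twoK ι A B, z ≠ 0 →
      ∃ h ∈ twoK ι A B, h ≠ 0 ∧ conformal h z ∧ ∀ c, |h c| ≤ K := by
  choose K hK using fun p : (Fin sA → Fin tA → ℤ) × (Fin sA → Fin tB → ℤ) =>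
    two_stage (Matrix.of p.1) (Matrix.of p.2)
  let F : Finset ((Fin sA → Fin tA → ℤ) × (Fin sA → Fin tB → ℤ)) :=
    Finset.Icc (fun _ _ => -(Δ:ℤ)) (fun _ _ => (Δ:ℤ)) ×ˢ Finset.Icc (fun _ _ => -(Δ:ℤ)) (fun _ _ => (Δ:ℤ))
  refine ⟨F.sup K, ?_⟩
  intro A B hA hB ι _ z hz hz0
  have hmem : ((fun i j => A i j, fun i j => B i j) :
      (Fin sA → Fin tA → ℤ) × (Fin sA → Fin tB → ℤ)) ∈ F := by
    simp only [F, Finset.mem_product, Finset.mem_Icc]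
    exact ⟨⟨fun i j => (abs_le.1 (hA i j)).1, fun i j => (abs_le.1 (hA i j)).2⟩,
      ⟨fun i j => (abs_le.1 (hB i j)).1, fun i j => (abs_le.1 (hB i j)).2⟩⟩
  obtain ⟨h, h1, h2, h3, h4⟩ := hK (fun i j => A i j, fun i j => B i j) ι z hz hz0
  refine ⟨h, h1, h2, h3, fun c => (h4 c).trans ?_⟩
  exact_mod_cast Finset.le_sup (f := K) hmem

theorem ext_point {ι κ : Type*} [Fintype κ] (v : ι → κ → ℚ) (s : Finset ι) :
    ∀ (m : ℕ) (w : ι → ℚ), (∀ i ∈ s, 0 ≤ w i ∧ w i ≤ 1) →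
    (s.filter fun i => 0 < w i ∧ w i < 1).card ≤ m →
    ∃ u : ι → ℚ, (∀ i ∈ s, 0 ≤ u i ∧ u i ≤ 1) ∧ ∑ i ∈ s, u i = ∑ i ∈ s, w i ∧
      (∀ k, ∑ i ∈ s, u i * v i k = ∑ i ∈ s, w i * v i k) ∧
      (s.filter fun i => 0 < u i ∧ u i < 1).card ≤ Fintype.card κ + 1 := by
  classical
  intro m
  induction m with
  | zero =>
    intro w hw hc
    exact ⟨w, hw, rfl, fun _ => rfl, by omega⟩
  | succ m ih =>
    intro w hw hc
    by_cases hle : (s.filter fun i => 0 < w i ∧ w i < 1).card ≤ Fintype.card κ + 1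
    · exact ⟨w, hw, rfl, fun _ => rfl, hle⟩
    set F := s.filter fun i => 0 < w i ∧ w i < 1 with hF
    have hdep : ¬ LinearIndependent ℚ (fun i : F => ((v i, 1) : (κ → ℚ) × ℚ)) := by
      intro hli
      have := hli.fintype_card_le_finrank
      simp at this
      omega
    obtain ⟨c0, hc0, i0, hi0⟩ := Fintype.not_linearIndependent_iff.1 hdep
    let c : ι → ℚ := fun i => if h : i ∈ F then c0 ⟨i, h⟩ else 0
    have hcF : ∀ i, i ∉ F → c i = 0 := fun i hi => by simp [c, hi]
    have hcsub : ∀ i : F, c i = c0 i := fun i => by simp [c]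
    have hFs : F ⊆ s := Finset.filter_subset _ _
    have hc1 : ∑ i ∈ s, c i = 0 := by
      rw [← Finset.sum_subset hFs (fun i _ hi => hcF i hi), ← Finset.sum_coe_sort]
      have := congrArg Prod.snd hc0
      simp only [Prod.snd_sum, Prod.smul_snd, smul_eq_mul, mul_one, Prod.snd_zero] at this
      rw [← this]
      exact Finset.sum_congr rfl fun i _ => hcsub i
    have hc2 : ∀ k, ∑ i ∈ s, c i * v i k = 0 := by
      intro k
      rw [← Finset.sum_subset hFs (fun i _ hi => by rw [hcF i hi, zero_mul]), ← Finset.sum_coe_sort]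
      have := congrFun (congrArg Prod.fst hc0) k
      simp only [Prod.fst_sum, Prod.smul_fst, Prod.fst_zero, Finset.sum_apply, Pi.smul_apply,
        smul_eq_mul, Pi.zero_apply] at this
      rw [← this]
      exact Finset.sum_congr rfl fun i _ => by rw [hcsub i]
    obtain ⟨a, ha, hmin⟩ := Finset.exists_min_image (F.filter fun i => c i ≠ 0)
      (fun i => min (w i) (1 - w i) / |c i|) ⟨i0, by simp [hcsub, hi0]⟩
    obtain ⟨haF, hca⟩ := Finset.mem_filter.1 ha
    have hwF : ∀ i ∈ F, 0 < w i ∧ w i < 1 := fun i hi => (Finset.mem_filter.1 hi).2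
    let τ0 := min (w a) (1 - w a) / |c a|
    -- sign choice
    obtain ⟨τ, hτabs, hτa⟩ : ∃ τ : ℚ, |τ| = τ0 ∧ (w a + τ * c a = 0 ∨ w a + τ * c a = 1) := by
      have hpos : 0 ≤ τ0 := by
        have := hwF a haF
        apply div_nonneg (le_min this.1.le (by linarith)) (abs_nonneg _)
      rcases le_total (w a) (1 - w a) with h | h
      · refine ⟨-(w a) / c a, ?_, Or.inl (by field_simp; ring)⟩
        simp only [τ0, min_eq_left h, abs_div, abs_neg]
        rw [abs_of_pos (hwF a haF).1]
      · refine ⟨(1 - w a) / c a, ?_, Or.inr (by field_simp; ring)⟩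
        simp only [τ0, min_eq_right h, abs_div]
        rw [abs_of_pos (a := 1 - w a) (by linarith [(hwF a haF).2])]
    let w' : ι → ℚ := fun i => w i + τ * c i
    have hw' : ∀ i ∈ s, 0 ≤ w' i ∧ w' i ≤ 1 := by
      intro i hi
      by_cases hci : c i = 0
      · simpa [w', hci] using hw i hi
      · have hiF : i ∈ F := by
          by_contra h; exact hci (hcF i h)
        have h1 := hmin i (Finset.mem_filter.2 ⟨hiF, hci⟩)
        change τ0 ≤ _ at h1
        rw [← hτabs, le_div_iff₀ (abs_pos.2 hci), ← abs_mul] at h1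
        have h2 := abs_le.1 h1
        have h3 := min_le_left (w i) (1 - w i)
        have h4 := min_le_right (w i) (1 - w i)
        simp only [w']
        constructor <;> linarith [h2.1, h2.2]
    have hcard : (s.filter fun i => 0 < w' i ∧ w' i < 1).card ≤ m := by
      have hlt : (s.filter fun i => 0 < w' i ∧ w' i < 1).card < F.card := by
        apply Finset.card_lt_card
        refine (Finset.ssubset_iff_of_subset ?_).2 ⟨a, haF, ?_⟩
        · intro i hi
          obtain ⟨his, hi2⟩ := Finset.mem_filter.1 hi
          by_contra h
          apply h
          simp only [w', hcF i h, mul_zero, add_zero] at hi2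
          exact Finset.mem_filter.2 ⟨his, hi2⟩
        · intro h
          have h2 := (Finset.mem_filter.1 h).2
          simp only [w'] at h2
          rcases hτa with h3 | h3 <;> rw [h3] at h2 <;> simp at h2
      omega
    obtain ⟨u, hu1, hu2, hu3, hu4⟩ := ih w' hw' hcard
    refine ⟨u, hu1, ?_, ?_, hu4⟩
    · rw [hu2]; simp only [w']; rw [Finset.sum_add_distrib, ← Finset.mul_sum, hc1]; simp
    · intro k
      rw [hu3]
      have : ∀ i ∈ s, w' i * v i k = w i * v i k + τ * (c i * v i k) := fun i _ => by
        simp only [w']; ring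
      rw [Finset.sum_congr rfl this, Finset.sum_add_distrib, ← Finset.mul_sum, hc2]; simp

theorem steinitz {ι κ : Type*} [Fintype κ] (v : ι → κ → ℚ) (M : ℚ) (hM0 : 0 ≤ M)
    (hM : ∀ i k, |v i k| ≤ M) : ∀ (m : ℕ) (s : Finset ι), s.card = m →
    (s.card ≤ Fintype.card κ ∨ ∃ w : ι → ℚ, (∀ i ∈ s, 0 ≤ w i ∧ w i ≤ 1) ∧
      ∑ i ∈ s, w i = s.card - Fintype.card κ ∧ ∀ k, ∑ i ∈ s, w i * v i k = 0) →
    ∃ Ch : ℕ → Finset ι, Ch m = s ∧ (∀ j ≤ m, (Ch j).card = j ∧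
      ∀ k, |∑ i ∈ Ch j, v i k| ≤ Fintype.card κ * M) ∧
      ∀ i j, i ≤ j → j ≤ m → Ch i ⊆ Ch j := by
  classical
  have bound : ∀ s : Finset ι, (s.card ≤ Fintype.card κ ∨ ∃ w : ι → ℚ, (∀ i ∈ s, 0 ≤ w i ∧ w i ≤ 1) ∧
      ∑ i ∈ s, w i = s.card - Fintype.card κ ∧ ∀ k, ∑ i ∈ s, w i * v i k = 0) →
      ∀ k, |∑ i ∈ s, v i k| ≤ Fintype.card κ * M := by
    rintro s (h | ⟨w, hw1, hw2, hw3⟩) k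
    · calc |∑ i ∈ s, v i k| ≤ ∑ i ∈ s, |v i k| := Finset.abs_sum_le_sum_abs _ _
          _ ≤ ∑ i ∈ s, M := Finset.sum_le_sum fun i _ => hM i k
          _ = s.card * M := by simp
          _ ≤ _ := mul_le_mul_of_nonneg_right (by exact_mod_cast h) hM0
    · have e : ∑ i ∈ s, v i k = ∑ i ∈ s, (1 - w i) * v i k := by
        simp only [sub_mul, one_mul, Finset.sum_sub_distrib, hw3, sub_zero]
      rw [e]
      calc |∑ i ∈ s, (1 - w i) * v i k| ≤ ∑ i ∈ s, |(1 - w i) * v i k| :=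
            Finset.abs_sum_le_sum_abs _ _
        _ ≤ ∑ i ∈ s, (1 - w i) * M := by
            apply Finset.sum_le_sum
            intro i hi
            have := hw1 i hi
            rw [abs_mul, abs_of_nonneg (by linarith : 0 ≤ 1 - w i)]
            exact mul_le_mul_of_nonneg_left (hM i k) (by linarith)
        _ = _ := by
            rw [← Finset.sum_mul, Finset.sum_sub_distrib, hw2]; simp
  intro m
  induction m with
  | zero =>
    intro s hs hP
    refine ⟨fun _ => s, rfl, ?_, fun _ _ _ _ => subset_rfl⟩
    intro j hj
    exact ⟨by show s.card = j; omega, bound s hP⟩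
  | succ m ih =>
    intro s hs hP
    obtain ⟨a, has, hPa⟩ : ∃ a ∈ s, ((s.erase a).card ≤ Fintype.card κ ∨
        ∃ w : ι → ℚ, (∀ i ∈ s.erase a, 0 ≤ w i ∧ w i ≤ 1) ∧
        ∑ i ∈ s.erase a, w i = (s.erase a).card - Fintype.card κ ∧
        ∀ k, ∑ i ∈ s.erase a, w i * v i k = 0) := by
      by_cases hm : m ≤ Fintype.card κ
      · obtain ⟨a, ha⟩ : s.Nonempty := Finset.card_pos.1 (by omega)
        exact ⟨a, ha, Or.inl (by rw [Finset.card_erase_of_mem ha]; omega)⟩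
      · rcases hP with h | ⟨w, hw1, hw2, hw3⟩
        · omega
        have hmQ : (Fintype.card κ : ℚ) + 1 ≤ m := by exact_mod_cast (by omega : Fintype.card κ + 1 ≤ m)
        rw [hs] at hw2
        push_cast at hw2
        have hden : (0:ℚ) < m + 1 - Fintype.card κ := by linarith
        let r : ℚ := (m - Fintype.card κ) / (m + 1 - Fintype.card κ)
        have hr0 : 0 ≤ r := div_nonneg (by linarith) hden.le
        have hr1 : r ≤ 1 := by rw [div_le_one hden]; linarith
        obtain ⟨u, hu1, hu2, hu3, hu4⟩ := ext_point v s _ (fun i => r * w i) (fun i hi => by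
          have := hw1 i hi
          exact ⟨mul_nonneg hr0 this.1, by nlinarith⟩) le_rfl
        have hsum : ∑ i ∈ s, u i = m - Fintype.card κ := by
          rw [hu2, ← Finset.mul_sum, hw2]
          simp only [r]; field_simp
        have hsum0 : ∀ k, ∑ i ∈ s, u i * v i k = 0 := by
          intro k
          rw [hu3]
          simp only [mul_assoc]
          rw [← Finset.mul_sum, hw3, mul_zero]
        obtain ⟨a, ha, hua⟩ : ∃ a ∈ s, u a = 0 := by
          by_contra hcon
          push Not at hcon
          set F := s.filter fun i => 0 < u i ∧ u i < 1 with hF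
          have e1 : ∑ i ∈ s, (1 - u i) = Fintype.card κ + 1 := by
            rw [Finset.sum_sub_distrib, hsum]; simp [hs]; ring
          have e2 : ∑ i ∈ F, (1 - u i) = ∑ i ∈ s, (1 - u i) := by
            apply Finset.sum_subset (Finset.filter_subset _ _)
            intro i hi hiF
            have h1 := hu1 i hi
            have h2 : 0 < u i := lt_of_le_of_ne h1.1 (Ne.symm (hcon i hi))
            have h3 : ¬ u i < 1 := fun h => hiF (Finset.mem_filter.2 ⟨hi, h2, h⟩)
            linarith
          have hne : F.Nonempty := by
            by_contra h
            rw [Finset.not_nonempty_iff_eq_empty] at h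
            rw [h, Finset.sum_empty, e1] at e2
            have : (0:ℚ) ≤ Fintype.card κ := by positivity
            linarith
          have e3 : ∑ i ∈ F, (1 - u i) < ∑ i ∈ F, (1:ℚ) := by
            apply Finset.sum_lt_sum_of_nonempty hne
            intro i hi
            have := (Finset.mem_filter.1 hi).2.1
            linarith
          have e4 : (F.card : ℚ) ≤ Fintype.card κ + 1 := by exact_mod_cast hu4
          simp only [Finset.sum_const, nsmul_eq_mul, mul_one] at e3
          linarith
        refine ⟨a, ha, Or.inr ⟨u, fun i hi => hu1 i (Finset.mem_of_mem_erase hi), ?_, ?_⟩⟩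
        · rw [Finset.card_erase_of_mem ha, hs, Finset.sum_erase s hua, hsum]; simp
        · intro k
          rw [Finset.sum_erase s (by rw [hua, zero_mul]), hsum0]
    obtain ⟨Ch, h1, h2, h3⟩ := ih (s.erase a) (by rw [Finset.card_erase_of_mem has]; omega) hPa
    refine ⟨fun j => if j ≤ m then Ch j else s, by simp, ?_, ?_⟩
    · intro j hj
      by_cases hjm : j ≤ m
      · simpa [hjm] using h2 j hjm
      · simp only [hjm, if_false]
        exact ⟨by show s.card = j; omega, bound s hP⟩
    · intro i j hij hj
      by_cases hjm : j ≤ m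
      · simpa [hjm, hij.trans hjm] using h3 i j hij hjm
      · by_cases him : i ≤ m
        · simp only [hjm, him, if_false, if_true]
          refine (h3 i m him le_rfl).trans ?_
          rw [h1]; exact Finset.erase_subset _ _
        · simp [hjm, him]

theorem conf_sum {ι C : Type*} (z : C → ℤ) (v : ι → C → ℤ) (hv : ∀ i, conformal (v i) z)
    (U W : Finset ι) (hUW : U ⊆ W) : conformal (∑ i ∈ U, v i) (∑ i ∈ W, v i) := by
  rw [conf_iff']
  intro c
  have h' : ∀ i, ((0 ≤ v i c ∧ v i c ≤ z c) ∨ (z c ≤ v i c ∧ v i c ≤ 0)) :=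
    fun i => (conf_iff' _ _).1 (hv i) c
  simp only [Finset.sum_apply]
  rcases le_total 0 (z c) with hz | hz
  · have h0 : ∀ i, 0 ≤ v i c := fun i => by have := h' i; omega
    left
    exact ⟨Finset.sum_nonneg fun i _ => h0 i,
      Finset.sum_le_sum_of_subset_of_nonneg hUW fun i _ _ => h0 i⟩
  · have h0 : ∀ i, v i c ≤ 0 := fun i => by have := h' i; omega
    right
    refine ⟨?_, Finset.sum_nonpos fun i _ => h0 i⟩
    have := Finset.sum_le_sum_of_subset_of_nonneg (f := fun i => - v i c) hUW
      fun i _ _ => by have := h0 i; omega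
    simp only [Finset.sum_neg_distrib] at this
    omega

theorem sum_ne_zero {ι C : Type*} (z : C → ℤ) (v : ι → C → ℤ) (hv : ∀ i, conformal (v i) z)
    (hv0 : ∀ i, v i ≠ 0) (U : Finset ι) (hU : U.Nonempty) : ∑ i ∈ U, v i ≠ 0 := by
  obtain ⟨i, hi⟩ := hU
  intro h
  have h1 := conf_sum z v hv {i} U (by simpa using hi)
  rw [h, Finset.sum_singleton] at h1
  apply hv0 i
  funext c
  have := (h1 c).1
  simpa using this

/-- value of the linking row -/
def Dv {n sD tA tB : ℕ} (D : Matrix (Fin sD) (Fin tA) ℤ) (h : Fin tB ⊕ Fin n × Fin tA → ℤ)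
    (r : Fin sD) : ℤ := ∑ j, D r j * ∑ p, h (Sum.inr (p, j))

theorem Dv_sum {n sD tA tB : ℕ} (D : Matrix (Fin sD) (Fin tA) ℤ) {ι : Type*} (U : Finset ι)
    (v : ι → Fin tB ⊕ Fin n × Fin tA → ℤ) (r : Fin sD) :
    Dv D (∑ i ∈ U, v i) r = ∑ i ∈ U, Dv D (v i) r := by
  simp only [Dv, Finset.sum_apply]
  rw [Finset.sum_comm]
  apply Finset.sum_congr rfl
  intro j _
  rw [← Finset.mul_sum, Finset.sum_comm]

theorem mulVec_threeBlock {n sA tA sD tB : ℕ}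
    (A : Matrix (Fin sA) (Fin tA) ℤ) (B : Matrix (Fin sA) (Fin tB) ℤ)
    (D : Matrix (Fin sD) (Fin tA) ℤ) (h : Fin tB ⊕ Fin n × Fin tA → ℤ) :
    (threeBlock n sA tA sD tB A B D).mulVec h = 0 ↔ h ∈ twoK (Fin n) A B ∧ ∀ r, Dv D h r = 0 := by
  have h1 : ∀ r, (threeBlock n sA tA sD tB A B D).mulVec h (Sum.inl r) = Dv D h r := by
    intro r
    simp only [Matrix.mulVec, dotProduct, Fintype.sum_sum_type, threeBlock, Matrix.of_apply,
      zero_mul, Finset.sum_const_zero, zero_add, Dv, Fintype.sum_prod_type]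
    rw [Finset.sum_comm]
    simp only [Finset.mul_sum]
  have h2 : ∀ i r, (threeBlock n sA tA sD tB A B D).mulVec h (Sum.inr (i, r)) =
      B.mulVec (fun j => h (Sum.inl j)) r + A.mulVec (fun j => h (Sum.inr (i, j))) r := by
    intro i r
    simp only [Matrix.mulVec, dotProduct, Fintype.sum_sum_type, threeBlock, Matrix.of_apply,
      Fintype.sum_prod_type, ite_mul, zero_mul]
    congr 1
    rw [Finset.sum_eq_single i]
    · simp
    · intro b _ hb
      simp [Ne.symm hb]
    · simp
  constructor
  · intro h0
    refine ⟨fun i => funext fun r => ?_, fun r => ?_⟩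
    · rw [Pi.add_apply, ← h2, h0]; rfl
    · rw [← h1, h0]; rfl
  · rintro ⟨ha, hb⟩
    funext r
    rcases r with r | ⟨i, r⟩
    · rw [h1, hb]; rfl
    · rw [h2]; exact congrFun (ha i) r

theorem rows {sD tA : ℕ} (D : Matrix (Fin sD) (Fin tA) ℤ) :
    ∃ (κ : Type) (_ : Fintype κ) (a : κ → Fin sD), Fintype.card κ ≤ tA ∧
      ∀ w : Fin tA → ℤ, (∀ k, ∑ j, D (a k) j * w j = 0) → ∀ r, ∑ j, D r j * w j = 0 := by
  obtain ⟨κ, a, hinj, hspan, hli⟩ := exists_linearIndependent' ℚ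
    (fun r : Fin sD => fun j : Fin tA => (D r j : ℚ))
  haveI := Fintype.ofInjective a hinj
  refine ⟨κ, inferInstance, a, ?_, ?_⟩
  · simpa using hli.fintype_card_le_finrank
  · intro w hw r
    let φ : (Fin tA → ℚ) →ₗ[ℚ] ℚ := Fintype.linearCombination ℚ (fun j => (w j : ℚ))
    have hφ : ∀ r, φ (fun j => (D r j : ℚ)) = ((∑ j, D r j * w j : ℤ) : ℚ) := by
      intro r
      simp [φ, Fintype.linearCombination_apply]
    have hle : Submodule.span ℚ (Set.range (fun r : Fin sD => fun j : Fin tA => (D r j : ℚ))) ≤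
        LinearMap.ker φ := by
      rw [← hspan, Submodule.span_le]
      rintro _ ⟨k, rfl⟩
      show φ (fun j => (D (a k) j : ℚ)) = 0
      rw [hφ, hw]; simp
    have := hle (Submodule.subset_span ⟨r, rfl⟩)
    have h2 : φ (fun j => (D r j : ℚ)) = 0 := this
    rw [hφ] at h2
    exact_mod_cast h2

theorem Dv_bound {n sD tA tB : ℕ} (D : Matrix (Fin sD) (Fin tA) ℤ) (Δ K : ℕ)
    (hD : ∀ i j, |D i j| ≤ (Δ : ℤ)) (h : Fin tB ⊕ Fin n × Fin tA → ℤ) (hh : ∀ c, |h c| ≤ (K : ℤ))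
    (r : Fin sD) : |Dv D h r| ≤ ((tA * (Δ * (n * K)) : ℕ) : ℤ) := by
  have h1 : ∀ j, |∑ p : Fin n, h (Sum.inr (p, j))| ≤ ((n * K : ℕ) : ℤ) := by
    intro j
    calc |∑ p : Fin n, h (Sum.inr (p, j))| ≤ ∑ p : Fin n, |h (Sum.inr (p, j))| :=
          Finset.abs_sum_le_sum_abs _ _
      _ ≤ ∑ p : Fin n, (K : ℤ) := Finset.sum_le_sum fun p _ => hh _
      _ = _ := by simp
  calc |Dv D h r| ≤ ∑ j, |D r j * ∑ p, h (Sum.inr (p, j))| := Finset.abs_sum_le_sum_abs _ _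
    _ ≤ ∑ j : Fin tA, ((Δ * (n * K) : ℕ) : ℤ) := by
        apply Finset.sum_le_sum
        intro j _
        rw [abs_mul, Nat.cast_mul]
        exact mul_le_mul (hD r j) (h1 j) (abs_nonneg _) (by positivity)
    _ = _ := by simp

theorem length_bound {n sA tA sD tB : ℕ}
    (A : Matrix (Fin sA) (Fin tA) ℤ) (B : Matrix (Fin sA) (Fin tB) ℤ)
    (D : Matrix (Fin sD) (Fin tA) ℤ) (Δ K : ℕ)
    (hD : ∀ i j, |D i j| ≤ (Δ : ℤ)) (g : Fin tB ⊕ Fin n × Fin tA → ℤ)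
    (hg : g ∈ graverBasis (threeBlock n sA tA sD tB A B D)) (T : ℕ)
    (v : Fin T → Fin tB ⊕ Fin n × Fin tA → ℤ) (hsum : ∑ i, v i = g)
    (hv : ∀ i, v i ∈ twoK (Fin n) A B ∧ v i ≠ 0 ∧ conformal (v i) g ∧ ∀ c, |v i c| ≤ (K : ℤ)) :
    T ≤ (2 * (tA * (tA * (Δ * (n * K)))) + 1) ^ tA := by
  classical
  obtain ⟨κ, _, a, hκ, ha⟩ := rows D
  obtain ⟨hg0, hgne, hgmin⟩ := hg
  obtain ⟨hgK, hgD⟩ := (mulVec_threeBlock A B D g).1 hg0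
  set M : ℕ := tA * (Δ * (n * K)) with hM
  have hvM : ∀ i k, |((Dv D (v i) (a k) : ℤ) : ℚ)| ≤ (M : ℚ) := by
    intro i k
    have := Dv_bound D Δ K hD (v i) (hv i).2.2.2 (a k)
    exact_mod_cast this
  by_contra hcon
  push Not at hcon
  have hT : 0 < T := by omega
  obtain ⟨Ch, hC1, hC2, hC3⟩ := steinitz (fun (i : Fin T) (k : κ) => ((Dv D (v i) (a k) : ℤ) : ℚ))
    (M : ℚ) (by positivity) hvM T Finset.univ (by simp) (by
      by_cases hle : T ≤ Fintype.card κ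
      · left; simpa using hle
      · right
        have hTQ : (0:ℚ) < T := by exact_mod_cast hT
        have hle' : (Fintype.card κ : ℚ) ≤ T := by exact_mod_cast (by omega : Fintype.card κ ≤ T)
        refine ⟨fun _ => (T - Fintype.card κ) / T, fun i _ => ⟨div_nonneg (by linarith) hTQ.le, ?_⟩, ?_, ?_⟩
        · rw [div_le_one hTQ]
          have : (0:ℚ) ≤ Fintype.card κ := by positivity
          linarith
        · simp; field_simp
        · intro k
          rw [← Finset.mul_sum, ← Int.cast_sum, ← Dv_sum, hsum, hgD]; simp)
  have hbox : ∀ j ≤ T, (fun k => ∑ i ∈ Ch j, Dv D (v i) (a k)) ∈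
      Fintype.piFinset (fun _ : κ => Finset.Icc (-((tA * M : ℕ) : ℤ)) ((tA * M : ℕ) : ℤ)) := by
    intro j hj
    rw [Fintype.mem_piFinset]
    intro k
    rw [Finset.mem_Icc, ← abs_le]
    have h1 := (hC2 j hj).2 k
    rw [← Int.cast_sum] at h1
    have h2 : ((Fintype.card κ : ℚ)) * M ≤ tA * M :=
      mul_le_mul_of_nonneg_right (by exact_mod_cast hκ) (by positivity)
    have h3 := h1.trans h2
    exact_mod_cast h3
  have hcard : (Fintype.piFinset
      (fun _ : κ => Finset.Icc (-((tA * M : ℕ) : ℤ)) ((tA * M : ℕ) : ℤ))).card <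
      (Finset.Icc 1 T).card := by
    rw [Fintype.card_piFinset]
    simp only [Int.card_Icc, Finset.prod_const, Finset.card_univ, Nat.card_Icc]
    have e : (((tA * M : ℕ) : ℤ) + 1 - -((tA * M : ℕ) : ℤ)).toNat = 2 * (tA * M) + 1 := by omega
    rw [e]
    calc (2 * (tA * M) + 1) ^ Fintype.card κ ≤ (2 * (tA * M) + 1) ^ tA :=
          Nat.pow_le_pow_right (by omega) hκ
      _ < T + 1 - 1 := by omega
  have key : ∀ i j, 1 ≤ i → i < j → j ≤ T →
      (fun k => ∑ p ∈ Ch i, Dv D (v p) (a k)) = (fun k => ∑ p ∈ Ch j, Dv D (v p) (a k)) → False := by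
    intro i j hi hij hj heq
    have hsub := hC3 i j hij.le hj
    have hci := (hC2 i (by omega)).1
    have hcj := (hC2 j hj).1
    let U := Ch j \ Ch i
    have hU : U.Nonempty := by
      rw [← Finset.card_pos, Finset.card_sdiff_of_subset hsub]; omega
    have hUc : (Finset.univ \ U).Nonempty := by
      obtain ⟨p, hp⟩ : (Ch i).Nonempty := Finset.card_pos.1 (by omega)
      exact ⟨p, by simp [U, hp]⟩
    have hcf := fun i => (hv i).2.2.1
    have hn0 := fun i => (hv i).2.1
    have hz : ∀ k, Dv D (∑ p ∈ U, v p) (a k) = 0 := by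
      intro k
      rw [Dv_sum]
      have h1 := Finset.sum_sdiff (f := fun p => Dv D (v p) (a k)) hsub
      have h2 := congrFun heq k
      rw [h2] at h1
      simpa [U] using h1
    have hker : (threeBlock n sA tA sD tB A B D).mulVec (∑ p ∈ U, v p) = 0 := by
      rw [mulVec_threeBlock]
      exact ⟨AddSubgroup.sum_mem _ fun p _ => (hv p).1, ha _ hz⟩
    have heqg := hgmin _ hker (sum_ne_zero g v hcf hn0 U hU) (by
      have := conf_sum g v hcf U Finset.univ (Finset.subset_univ _)
      rwa [hsum] at this)
    have h3 := Finset.sum_sdiff (f := v) (Finset.subset_univ U)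
    rw [heqg, hsum] at h3
    exact sum_ne_zero g v hcf hn0 _ hUc (by simpa using h3)
  obtain ⟨i, hi, j, hj, hij, heq⟩ := Finset.exists_ne_map_eq_of_card_lt_of_maps_to hcard
    (f := fun j => (fun k => ∑ i ∈ Ch j, Dv D (v i) (a k)))
    (fun j hj => hbox j (Finset.mem_Icc.1 hj).2)
  rw [Finset.mem_Icc] at hi hj
  rcases lt_or_gt_of_ne hij with h | h
  · exact key i j hi.1 h hj.2 heq
  · exact key j i hj.1 h hi.2 heq.symm

end TB

/-- The `ℓ∞`-norm of any Graver basis element of a 3-block n-fold matrix is at most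
`c · n^{t_A² + 1}` where `c` depends only on the parameters of the small matrices. -/
theorem graver_upper_bound_threeBlock
    (sA tA sD tB Δ : ℕ) (hsA : 0 < sA) (htA : 0 < tA) (hsD : 0 < sD)
    (htB : 0 < tB) (hΔ : 0 < Δ) :
    ∃ c : ℕ, ∀ n : ℕ, 1 ≤ n →
      ∀ (A : Matrix (Fin sA) (Fin tA) ℤ) (B : Matrix (Fin sA) (Fin tB) ℤ)
        (D : Matrix (Fin sD) (Fin tA) ℤ),
      (∀ i j, |A i j| ≤ (Δ : ℤ)) → (∀ i j, |B i j| ≤ (Δ : ℤ)) →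
      (∀ i j, |D i j| ≤ (Δ : ℤ)) →
      ∀ g ∈ graverBasis (threeBlock n sA tA sD tB A B D),
      ∀ i, |g i| ≤ (c : ℤ) * (n : ℤ) ^ (tA ^ 2 + 1) := by
  obtain ⟨K, hK⟩ := TB.two_stage_unif sA tA tB Δ
  refine ⟨(2 * (tA * (tA * (Δ * K))) + 1) ^ tA * K, ?_⟩
  intro n hn A B D hA hB hD g hg c
  haveI : Nonempty (Fin n) := ⟨⟨0, hn⟩⟩
  have hgK := ((TB.mulVec_threeBlock A B D g).1 hg.1).1
  obtain ⟨l, hl, hl2⟩ := TB.decomp (TB.twoK (Fin n) A B) {h | ∀ c, |h c| ≤ (K : ℤ)}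
    (fun z hz hz0 => by
      obtain ⟨h, h1, h2, h3, h4⟩ := hK A B hA hB (Fin n) z hz hz0
      exact ⟨h, h4, h1, h2, h3⟩) g hgK
  have hT := TB.length_bound A B D Δ K hD g hg l.length (fun i => l.get i)
    (by rw [← hl]; simp [Fin.sum_univ_getElem]) (fun i => by
      obtain ⟨h1, h2, h3, h4⟩ := hl2 (l.get i) (List.get_mem l i)
      exact ⟨h2, h3, h4, h1⟩)
  have h1 : |g c| ≤ (l.length : ℤ) * K := by
    have e := TB.abs_list_sum g l (fun h hh => (hl2 h hh).2.2.2) c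
    rw [hl] at e
    rw [e]
    have := List.sum_le_card_nsmul (l.map (fun h => |h c|)) (K : ℤ) (by
      intro x hx
      obtain ⟨h, hh, rfl⟩ := List.mem_map.1 hx
      exact (hl2 h hh).1 c)
    simpa using this
  have h2 : l.length ≤ (2 * (tA * (tA * (Δ * K))) + 1) ^ tA * n ^ (tA ^ 2 + 1) := by
    calc l.length ≤ (2 * (tA * (tA * (Δ * (n * K)))) + 1) ^ tA := hT
      _ ≤ ((2 * (tA * (tA * (Δ * K))) + 1) * n) ^ tA := by
          apply Nat.pow_le_pow_left
          have : 2 * (tA * (tA * (Δ * (n * K)))) = 2 * (tA * (tA * (Δ * K))) * n := by ring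
          rw [this, add_mul]; omega
      _ = (2 * (tA * (tA * (Δ * K))) + 1) ^ tA * n ^ tA := by rw [mul_pow]
      _ ≤ _ := by
          apply Nat.mul_le_mul_left
          apply Nat.pow_le_pow_right hn
          nlinarith
  calc |g c| ≤ (l.length : ℤ) * K := h1
    _ ≤ (((2 * (tA * (tA * (Δ * K))) + 1) ^ tA * n ^ (tA ^ 2 + 1) : ℕ) : ℤ) * K :=
        mul_le_mul_of_nonneg_right (by exact_mod_cast h2) (by positivity)
    _ = _ := by push_cast; ring
end

section
/- Let ζ ≥ 1 be an integer and let x_1, x_2, …, x_m be integers with |x_i| ≤ ζ for all i, and set x = x_1 + … + x_m. Then {1, …, m} can be partitioned into subsets T_1, …, T_{m'} such that for every j one has |T_j| ≤ 6ζ + 2 and Σ_{i∈T_j} x_i ⊑ x (i.e., the subset sum has the same sign as x and absolute value at most |x|). -/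
theorem ml_find {ι : Type*} [DecidableEq ι] (ζ : ℕ) (hζ : 1 ≤ ζ) (x : ι → ℤ)
    (hx : ∀ i, |x i| ≤ (ζ : ℤ)) (s : Finset ι) (hs : 2 * ζ ≤ s.card)
    (h0 : 0 ≤ ∑ i ∈ s, x i) :
    ∃ S ⊆ s, S.Nonempty ∧ S.card ≤ 2 * ζ ∧ 0 ≤ ∑ i ∈ S, x i ∧
      ∑ i ∈ S, x i ≤ ∑ i ∈ s, x i := by
  by_cases hsing : ∃ a ∈ s, 0 ≤ x a ∧ x a ≤ ∑ i ∈ s, x i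
  · obtain ⟨a, ha, h1, h2⟩ := hsing
    exact ⟨{a}, by simpa using ha, by simp, by simp; omega, by simpa using h1, by simpa using h2⟩
  push Not at hsing
  have step : ∀ A : Finset ι, ∃ B : Finset ι, A ⊆ B ∧
      (A ⊂ s ∧ 1 - (ζ : ℤ) ≤ ∑ i ∈ A, x i ∧ ∑ i ∈ A, x i ≤ ζ →
        B ⊆ s ∧ B.card = A.card + 1 ∧ 1 - (ζ : ℤ) ≤ ∑ i ∈ B, x i ∧ ∑ i ∈ B, x i ≤ ζ) := by
    intro A
    by_cases hA : A ⊂ s ∧ 1 - (ζ : ℤ) ≤ ∑ i ∈ A, x i ∧ ∑ i ∈ A, x i ≤ ζ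
    swap
    · exact ⟨A, subset_rfl, fun h => absurd h hA⟩
    obtain ⟨hAs, h1, h2⟩ := hA
    have hsum := Finset.sum_sdiff (f := x) hAs.1
    have hne : (s \ A).Nonempty := Finset.sdiff_nonempty.2 hAs.2
    have key : ∃ a ∈ s \ A, 1 - (ζ : ℤ) ≤ x a + ∑ i ∈ A, x i ∧ x a + ∑ i ∈ A, x i ≤ ζ := by
      by_cases hP : ∑ i ∈ A, x i ≤ 0
      · have : ∃ a ∈ s \ A, 0 ≤ x a := by
          by_contra! hc
          have := Finset.sum_neg hc hne
          omega
        obtain ⟨a, ha, h⟩ := this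
        have := abs_le.1 (hx a)
        exact ⟨a, ha, by omega, by omega⟩
      · have : ∃ a ∈ s \ A, x a < 0 := by
          by_contra! hc
          obtain ⟨a, ha⟩ := hne
          have h3 := Finset.single_le_sum hc ha
          have h4 := hsing a (Finset.mem_sdiff.1 ha).1 (hc a ha)
          omega
        obtain ⟨a, ha, h⟩ := this
        have := abs_le.1 (hx a)
        exact ⟨a, ha, by omega, by omega⟩
    obtain ⟨a, ha, h3, h4⟩ := key
    obtain ⟨has, haA⟩ := Finset.mem_sdiff.1 ha
    refine ⟨insert a A, Finset.subset_insert _ _, fun _ => ⟨?_, ?_, ?_⟩⟩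
    · exact Finset.insert_subset has hAs.1
    · exact Finset.card_insert_of_notMem haA
    · rw [Finset.sum_insert haA]; exact ⟨h3, h4⟩
  choose g hg1 hg2 using step
  let f : ℕ → Finset ι := fun n => g^[n] ∅
  have hf : ∀ n, f (n + 1) = g (f n) := fun n => Function.iterate_succ_apply' g n ∅
  have mono : Monotone f := monotone_nat_of_le_succ (fun n => by rw [hf]; exact hg1 _)
  have inv : ∀ n, n ≤ 2 * ζ → f n ⊆ s ∧ (f n).card = n ∧
      1 - (ζ : ℤ) ≤ ∑ i ∈ f n, x i ∧ ∑ i ∈ f n, x i ≤ ζ := by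
    intro n
    induction n with
    | zero => intro _; simp [f]; omega
    | succ k ih =>
      intro hk
      obtain ⟨a1, a2, a3⟩ := ih (by omega)
      have hss : f k ⊂ s := by
        refine lt_of_le_of_ne a1 ?_
        intro h
        rw [h] at a2
        omega
      have := hg2 (f k) ⟨hss, a3⟩
      rw [hf]
      rw [a2] at this
      exact this
  have pig : ∃ a ∈ Finset.range (2 * ζ + 1), ∃ b ∈ Finset.range (2 * ζ + 1), a ≠ b ∧
      ∑ i ∈ f a, x i = ∑ i ∈ f b, x i := by
    apply Finset.exists_ne_map_eq_of_card_lt_of_maps_to (t := Finset.Icc (1 - (ζ : ℤ)) ζ)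
    · simp; omega
    · intro n hn
      have hn' : n < 2 * ζ + 1 := by simpa using hn
      have := inv n (by omega)
      simpa using this.2.2
  have pig2 : ∃ a b, a < b ∧ b ≤ 2 * ζ ∧ ∑ i ∈ f a, x i = ∑ i ∈ f b, x i := by
    obtain ⟨a, ha, b, hb, hab, h⟩ := pig
    rw [Finset.mem_range] at ha hb
    rcases lt_or_gt_of_ne hab with h' | h'
    · exact ⟨a, b, h', by omega, h⟩
    · exact ⟨b, a, h', by omega, h.symm⟩
  obtain ⟨a, b, hab, hb, h⟩ := pig2
  have hsub : f a ⊆ f b := mono hab.le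
  have hsum := Finset.sum_sdiff (f := x) hsub
  have hcard := Finset.card_sdiff_add_card_eq_card hsub
  have ia := inv a (by omega)
  have ib := inv b hb
  refine ⟨f b \ f a, Finset.sdiff_subset.trans ib.1, ?_, ?_, ?_, ?_⟩
  · rw [← Finset.card_pos]; omega
  · omega
  · omega
  · omega

theorem ml_part {ι : Type*} [DecidableEq ι] (ζ : ℕ) (hζ : 1 ≤ ζ) (x : ι → ℤ)
    (hx : ∀ i, |x i| ≤ (ζ : ℤ)) (s : Finset ι) (h0 : 0 ≤ ∑ i ∈ s, x i) :
    ∃ P : Finset (Finset ι), (∀ A ∈ P, ∀ B ∈ P, A ≠ B → Disjoint A B) ∧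
      (∀ i ∈ s, ∃ A ∈ P, i ∈ A) ∧
      ∀ A ∈ P, A ⊆ s ∧ A.card ≤ 2 * ζ ∧ 0 ≤ ∑ i ∈ A, x i ∧
        ∑ i ∈ A, x i ≤ ∑ i ∈ s, x i := by
  induction s using Finset.strongInduction with
  | H s ih =>
    by_cases hs : s.card ≤ 2 * ζ
    · refine ⟨{s}, ?_, ?_, ?_⟩
      · intro A hA B hB hAB
        rw [Finset.mem_singleton] at hA hB
        exact absurd (hA.trans hB.symm) hAB
      · intro i hi
        exact ⟨s, by simp, hi⟩
      · intro A hA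
        rw [Finset.mem_singleton] at hA
        subst hA
        exact ⟨subset_rfl, hs, h0, le_rfl⟩
    obtain ⟨S, hSs, hne, hc, h1, h2⟩ := ml_find ζ hζ x hx s (by omega) h0
    have hsum := Finset.sum_sdiff (f := x) hSs
    obtain ⟨P, p1, p2, p3⟩ := ih (s \ S) (Finset.sdiff_ssubset hSs hne) (by omega)
    have hd : ∀ A ∈ P, Disjoint A S := fun A hA =>
      Finset.disjoint_of_subset_left (p3 A hA).1 Finset.sdiff_disjoint
    refine ⟨insert S P, ?_, ?_, ?_⟩
    · intro A hA B hB hAB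
      rcases Finset.mem_insert.1 hA with rfl | hA' <;> rcases Finset.mem_insert.1 hB with rfl | hB'
      · exact absurd rfl hAB
      · exact (hd B hB').symm
      · exact hd A hA'
      · exact p1 A hA' B hB' hAB
    · intro i hi
      by_cases hiS : i ∈ S
      · exact ⟨S, Finset.mem_insert_self _ _, hiS⟩
      · obtain ⟨A, hA, hiA⟩ := p2 i (Finset.mem_sdiff.2 ⟨hi, hiS⟩)
        exact ⟨A, Finset.mem_insert_of_mem hA, hiA⟩
    · intro A hA
      rcases Finset.mem_insert.1 hA with rfl | hA'
      · exact ⟨hSs, hc, h1, h2⟩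
      · obtain ⟨q1, q2, q3, q4⟩ := p3 A hA'
        exact ⟨q1.trans Finset.sdiff_subset, q2, q3, by omega⟩

theorem ml_nonneg (ζ : ℕ) (hζ : 1 ≤ ζ) (m : ℕ) (x : Fin m → ℤ)
    (hx : ∀ i, |x i| ≤ (ζ : ℤ)) (h0 : 0 ≤ ∑ i, x i) :
    ∃ (m' : ℕ) (T : Fin m' → Finset (Fin m)),
      (∀ j j', j ≠ j' → Disjoint (T j) (T j')) ∧
      (∀ i, ∃ j, i ∈ T j) ∧
      ∀ j, (T j).card ≤ 6 * ζ + 2 ∧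
        |∑ i ∈ T j, x i| ≤ |∑ i, x i| ∧
        0 ≤ (∑ i ∈ T j, x i) * (∑ i, x i) := by
  obtain ⟨P, p1, p2, p3⟩ := ml_part ζ hζ x hx Finset.univ h0
  refine ⟨P.card, fun j => (P.equivFin.symm j : Finset (Fin m)), ?_, ?_, ?_⟩
  · intro j j' hj
    refine p1 _ (P.equivFin.symm j).2 _ (P.equivFin.symm j').2 ?_
    intro h
    exact hj (P.equivFin.symm.injective (Subtype.ext h))
  · intro i
    obtain ⟨A, hA, hi⟩ := p2 i (Finset.mem_univ i)
    exact ⟨P.equivFin ⟨A, hA⟩, by simpa using hi⟩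
  · intro j
    obtain ⟨-, q2, q3, q4⟩ := p3 _ (P.equivFin.symm j).2
    refine ⟨q2.trans (by omega), ?_, mul_nonneg q3 h0⟩
    rw [abs_of_nonneg q3, abs_of_nonneg h0]
    exact q4

/-- Merging lemma in dimension one: integers `x_1, …, x_m` with `|x_i| ≤ ζ` can be
partitioned into subsets of cardinality at most `6ζ + 2` each of whose sums is
sign-compatible with, and no larger in absolute value than, the total sum. -/
theorem merging_lemma_dim_one (ζ : ℕ) (hζ : 1 ≤ ζ) (m : ℕ) (x : Fin m → ℤ)
    (hx : ∀ i, |x i| ≤ (ζ : ℤ)) :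
    ∃ (m' : ℕ) (T : Fin m' → Finset (Fin m)),
      (∀ j j', j ≠ j' → Disjoint (T j) (T j')) ∧
      (∀ i, ∃ j, i ∈ T j) ∧
      ∀ j, (T j).card ≤ 6 * ζ + 2 ∧
        |∑ i ∈ T j, x i| ≤ |∑ i, x i| ∧
        0 ≤ (∑ i ∈ T j, x i) * (∑ i, x i) := by
  rcases le_total 0 (∑ i, x i) with h0 | h0
  · exact ml_nonneg ζ hζ m x hx h0
  · obtain ⟨m', T, h1, h2, h3⟩ := ml_nonneg ζ hζ m (fun i => - x i)
      (fun i => by rw [abs_neg]; exact hx i) (by rw [Finset.sum_neg_distrib]; omega)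
    refine ⟨m', T, h1, h2, fun j => ?_⟩
    have := h3 j
    simpa only [Finset.sum_neg_distrib, abs_neg, neg_mul_neg] using this
end

section
/- There exists an absolute constant c ≥ 1 such that the following holds for all integers κ ≥ 1 and ζ ≥ 1. Let x_1, x_2, …, x_m be vectors in Z^κ with ‖x_i‖_∞ ≤ ζ for all i, and set x = x_1 + … + x_m. Then {1, …, m} can be partitioned into subsets T_1, …, T_{m'} such that for every j one has Σ_{i∈T_j} x_i ⊑ x and |T_j| ≤ (c·ζ)^{κ²}. -/
theorem intker {κ ζ : ℕ} (hζ : 1 ≤ ζ) {β : Type} [Fintype β] (M : Fin κ → β → ℤ)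
    (hM : ∀ j b, |M j b| ≤ (ζ : ℤ)) (u : β → ℚ) (hu : u ≠ 0)
    (hMu : ∀ j, ∑ b, (M j b : ℚ) * u b = 0) (hcard : Fintype.card β ≤ κ + 1) :
    ∃ t : β → ℤ, t ≠ 0 ∧ (∀ j, ∑ b, M j b * t b = 0) ∧
      ∀ b, (t b).natAbs ≤ ((κ + 1) * ζ) ^ κ := by
  classical
  obtain ⟨γ, a, ha, hspan, hli⟩ :=
    exists_linearIndependent' (K := ℚ) (fun j : Fin κ => fun b : β => (M j b : ℚ))
  have : Finite γ := Finite.of_injective a ha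
  let _ : Fintype γ := Fintype.ofFinite γ
  let _ : NormedAddCommGroup (Matrix γ β ℤ) := Matrix.normedAddCommGroup
  have hγκ : Fintype.card γ ≤ κ := by
    simpa using Fintype.card_le_of_injective a ha
  -- a vector killed by the chosen rows is killed by all rows
  have key : ∀ t : β → ℚ, (∀ g, ∑ b, (M (a g) b : ℚ) * t b = 0) →
      ∀ j, ∑ b, (M j b : ℚ) * t b = 0 := by
    intro t ht j
    let φ : (β → ℚ) →ₗ[ℚ] ℚ := ∑ b, t b • LinearMap.proj b
    have hφ : ∀ v : β → ℚ, φ v = ∑ b, v b * t b := by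
      intro v
      simp [φ, mul_comm]
    have hle : Submodule.span ℚ (Set.range ((fun j : Fin κ => fun b : β => (M j b : ℚ)) ∘ a))
        ≤ LinearMap.ker φ := by
      rw [Submodule.span_le]
      rintro _ ⟨g, rfl⟩
      simp only [SetLike.mem_coe, LinearMap.mem_ker, hφ]
      exact ht g
    rw [hspan] at hle
    have := hle (Submodule.subset_span ⟨j, rfl⟩)
    rw [LinearMap.mem_ker, hφ] at this
    exact this
  have hγβ : Fintype.card γ < Fintype.card β := by
    rw [← finrank_span_eq_card hli, ← Module.finrank_fintype_fun_eq_card (R := ℚ) (η := β)]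
    apply Submodule.finrank_lt
    intro htop
    let φ : (β → ℚ) →ₗ[ℚ] ℚ := ∑ b, u b • LinearMap.proj b
    have hφ : ∀ v : β → ℚ, φ v = ∑ b, v b * u b := by
      intro v
      simp [φ, mul_comm]
    have hle : Submodule.span ℚ (Set.range ((fun j : Fin κ => fun b : β => (M j b : ℚ)) ∘ a))
        ≤ LinearMap.ker φ := by
      rw [Submodule.span_le]
      rintro _ ⟨g, rfl⟩
      simp only [SetLike.mem_coe, LinearMap.mem_ker, hφ]
      exact hMu (a g)
    rw [htop] at hle
    apply hu
    funext b
    have := hle (x := Pi.single b 1) trivial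
    rw [LinearMap.mem_ker, hφ] at this
    simpa [Pi.single_apply] using this
  have main : ∃ t : β → ℤ, t ≠ 0 ∧ (∀ g, ∑ b, M (a g) b * t b = 0) ∧
      ∀ b, (t b).natAbs ≤ ((κ + 1) * ζ) ^ κ := by
    rcases Nat.eq_zero_or_pos (Fintype.card γ) with h0 | hpos
    · have : IsEmpty γ := Fintype.card_eq_zero_iff.mp h0
      have hne : Nonempty β := Fintype.card_pos_iff.mp (by omega)
      refine ⟨fun _ => 1, ?_, fun g => isEmptyElim g, fun b => ?_⟩
      · intro h
        have := congrFun h (Classical.arbitrary β)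
        simp at this
      · simpa using Nat.one_le_pow _ _ (by positivity)
    · obtain ⟨t, ht0, ht, hnorm⟩ := Int.Matrix.exists_ne_zero_int_vec_norm_le
        (Matrix.of fun g b => M (a g) b) hγβ hpos
      refine ⟨t, ht0, fun g => ?_, fun b => ?_⟩
      · have := congrFun ht g
        simpa [Matrix.mulVec, dotProduct] using this
      · have hA : max 1 ‖(Matrix.of fun g b => M (a g) b)‖ ≤ (ζ : ℝ) := by
          apply max_le
          · exact_mod_cast hζ
          · rw [Matrix.norm_le_iff (by positivity)]
            intro i j
            rw [Matrix.of_apply, Int.norm_eq_abs]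
            exact_mod_cast hM (a i) j
        have h1 : ‖t b‖ ≤ (((κ + 1) * ζ) ^ κ : ℝ) := by
          refine (norm_le_pi_norm t b).trans (hnorm.trans ?_)
          have hb : ((Fintype.card β : ℝ) *
              max 1 ‖(Matrix.of fun g b => M (a g) b)‖) ≤ (κ + 1) * ζ := by
            have : (Fintype.card β : ℝ) ≤ κ + 1 := by exact_mod_cast hcard
            gcongr
          have h1' : (1 : ℝ) ≤ (κ + 1) * ζ := by
            have : (1 : ℝ) ≤ ζ := by exact_mod_cast hζ
            nlinarith [(Nat.cast_nonneg κ : (0 : ℝ) ≤ κ)]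
          have hd : (1 : ℝ) ≤ Fintype.card β - Fintype.card γ := by
            have : (Fintype.card γ : ℝ) + 1 ≤ Fintype.card β := by exact_mod_cast hγβ
            linarith
          rw [← Real.rpow_natCast]
          refine (Real.rpow_le_rpow (by positivity) hb (by positivity)).trans ?_
          apply Real.rpow_le_rpow_of_exponent_le h1'
          refine (div_le_self (by positivity) hd).trans ?_
          exact_mod_cast hγκ
        rw [Int.norm_eq_abs] at h1
        have h2 : |t b| ≤ (((κ + 1) * ζ) ^ κ : ℤ) := by exact_mod_cast h1
        have h3 : ((t b).natAbs : ℤ) ≤ (((κ + 1) * ζ) ^ κ : ℤ) := by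
          rwa [Int.natCast_natAbs]
        exact_mod_cast h3
  obtain ⟨t, ht0, ht, hb⟩ := main
  refine ⟨t, ht0, fun j => ?_, hb⟩
  have := key (fun b => (t b : ℚ)) (fun g => by exact_mod_cast ht g) j
  exact_mod_cast this

theorem circuit {κ ζ : ℕ} (hζ : 1 ≤ ζ) {ι : Type*} [Fintype ι] (w : ι → Fin κ → ℤ)
    (hw : ∀ i j, |w i j| ≤ (ζ : ℤ)) (z : ι → ℚ) (hz : ∀ i, 0 ≤ z i) (hz0 : z ≠ 0)
    (hzw : ∀ j, ∑ i, z i * (w i j : ℚ) = 0) :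
    ∃ c : ι → ℕ, c ≠ 0 ∧ (∀ i, c i ≠ 0 → z i ≠ 0) ∧ (∀ j, ∑ i, (c i : ℤ) * w i j = 0) ∧
      ∑ i, c i ≤ (κ + 1) * ((κ + 1) * ζ) ^ κ := by
  classical
  let W : ι → Fin κ → ℚ := fun i j => (w i j : ℚ)
  have hpos : 0 < ∑ i, z i := by
    obtain ⟨i, hi⟩ := Function.ne_iff.mp hz0
    exact Finset.sum_pos' (fun i _ => hz i) ⟨i, Finset.mem_univ _, lt_of_le_of_ne (hz i) (Ne.symm hi)⟩
  have hmem : (0 : Fin κ → ℚ) ∈ convexHull ℚ (W '' {i | z i ≠ 0}) := by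
    have h := Finset.centerMass_mem_convexHull (R := ℚ) (s := W '' {i | z i ≠ 0})
      (Finset.univ.filter fun i => z i ≠ 0) (w := z) (fun i _ => hz i)
      (by rw [Finset.sum_filter_ne_zero]; exact hpos) (z := W)
      (fun i hi => ⟨i, by simpa using hi, rfl⟩)
    convert h using 1
    rw [Finset.centerMass]
    have : ∑ i with z i ≠ 0, z i • W i = 0 := by
      rw [Finset.sum_filter_of_ne]
      · funext j
        simpa [W] using (hzw j)
      · intro i _ h h'
        exact h (by rw [h', zero_smul])
    rw [this, smul_zero]
  obtain ⟨β, _, p, u, hrange, hai, hu, hu1, hup⟩ := eq_pos_convex_span_of_mem_convexHull hmem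
  choose f hf1 hf2 using fun b => hrange ⟨b, rfl⟩
  have hcard : Fintype.card β ≤ κ + 1 := by
    refine hai.card_le_finrank_succ.trans ?_
    have := Submodule.finrank_le (vectorSpan ℚ (Set.range p))
    simpa using this
  have hne : Nonempty β := by
    by_contra h
    rw [not_nonempty_iff] at h
    simp at hu1
  have hup' : ∀ j, ∑ b, (w (f b) j : ℚ) * u b = 0 := by
    intro j
    have := congrFun hup j
    simp only [Finset.sum_apply, Pi.smul_apply, smul_eq_mul, Pi.zero_apply] at this
    rw [← this]
    refine Finset.sum_congr rfl fun b _ => ?_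
    rw [← hf2 b, mul_comm]
  obtain ⟨t, ht0, ht, htb⟩ := intker hζ (fun j b => w (f b) j) (fun j b => hw _ _) u
    (fun h => by have := hu (Classical.arbitrary β); rw [h] at this; simp at this) hup' hcard
  -- `t` is a multiple of `u`
  have hmul : ∀ b, (t b : ℚ) = (∑ b, (t b : ℚ)) * u b := by
    intro b
    have := affineIndependent_iff.mp hai Finset.univ
      (fun b => (t b : ℚ) - (∑ b, (t b : ℚ)) * u b) ?_ ?_ b (Finset.mem_univ _)
    · linarith
    · rw [Finset.sum_sub_distrib, ← Finset.mul_sum, hu1]; ring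
    · simp only [sub_smul, Finset.sum_sub_distrib, mul_smul]
      rw [← Finset.smul_sum, hup, smul_zero, sub_zero]
      funext j
      have h := ht j
      have h' : ∑ b, (w (f b) j : ℚ) * (t b : ℚ) = 0 := by exact_mod_cast h
      simp only [Finset.sum_apply, Pi.smul_apply, smul_eq_mul, Pi.zero_apply]
      rw [← h']
      refine Finset.sum_congr rfl fun b _ => ?_
      rw [← hf2 b, mul_comm]
  have habs : ∀ b, ((t b).natAbs : ℚ) = |∑ b, (t b : ℚ)| * u b := by
    intro b
    rw [Nat.cast_natAbs, Int.cast_abs, hmul b, abs_mul, abs_of_pos (hu b)]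
  have hcsum : ∑ i, (∑ b, if f b = i then (t b).natAbs else 0) = ∑ b, (t b).natAbs := by
    rw [Finset.sum_comm]
    simp
  refine ⟨fun i => ∑ b, if f b = i then (t b).natAbs else 0, ?_, ?_, ?_, ?_⟩
  · intro h
    have h2 : ∑ b, (t b).natAbs = 0 := by
      rw [← hcsum]
      exact Finset.sum_eq_zero fun i _ => congrFun h i
    apply ht0
    funext b
    rw [Finset.sum_eq_zero_iff] at h2
    simpa using h2 b (Finset.mem_univ _)
  · intro i hi
    obtain ⟨b, _, hb⟩ := Finset.exists_ne_zero_of_sum_ne_zero hi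
    by_cases h : f b = i
    · rw [← h]; exact hf1 b
    · simp [h] at hb
  · intro j
    have h1 : ∑ i, ((∑ b, if f b = i then (t b).natAbs else 0 : ℕ) : ℤ) * w i j
        = ∑ b, ((t b).natAbs : ℤ) * w (f b) j := by
      push_cast
      simp_rw [Finset.sum_mul]
      rw [Finset.sum_comm]
      refine Finset.sum_congr rfl fun b _ => ?_
      simp
    rw [h1]
    have h2 : ∑ b, ((t b).natAbs : ℚ) * (w (f b) j : ℚ) = 0 := by
      simp_rw [habs, mul_assoc]
      rw [← Finset.mul_sum]
      have := hup' j
      simp_rw [mul_comm (u _)]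
      rw [this, mul_zero]
    have h3 : ((∑ b, ((t b).natAbs : ℤ) * w (f b) j : ℤ) : ℚ) = 0 := by
      rw [← h2]
      push_cast
      simp [Nat.cast_natAbs]
    exact_mod_cast h3
  · rw [hcsum]
    refine (Finset.sum_le_card_nsmul _ _ _ fun b _ => htb b).trans ?_
    rw [smul_eq_mul, Finset.card_univ]
    gcongr

theorem peel {κ ζ : ℕ} (hζ : 1 ≤ ζ) {ι : Type*} [Fintype ι] (w : ι → Fin κ → ℤ)
    (hw : ∀ i j, |w i j| ≤ (ζ : ℤ)) (B : ℕ) (hB : B = (κ + 1) * ((κ + 1) * ζ) ^ κ) :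
    ∀ (s : ℕ) (z : ι → ℚ), (∀ i, 0 ≤ z i) →
    (Finset.univ.filter fun i => z i ≠ 0).card ≤ s →
    (∀ j, ∑ i, z i * (w i j : ℚ) = 0) → (s * B : ℚ) < ∑ i, z i →
    ∃ c : ι → ℕ, c ≠ 0 ∧ (∀ i, (c i : ℚ) ≤ z i) ∧ (∀ j, ∑ i, (c i : ℤ) * w i j = 0) ∧
      ∑ i, c i ≤ B := by
  classical
  intro s
  induction s with
  | zero =>
    intro z hz hs hzw hlt
    exfalso
    have : ∑ i, z i = 0 := by
      apply Finset.sum_eq_zero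
      intro i _
      by_contra h
      have : i ∈ (Finset.univ.filter fun i => z i ≠ 0) := by simpa using h
      rw [Finset.card_eq_zero.mp (Nat.le_zero.mp hs)] at this
      simp at this
    rw [this] at hlt
    simp at hlt
  | succ s ih =>
    intro z hz hs hzw hlt
    have hz0 : z ≠ 0 := by
      rintro rfl
      have : (0 : ℚ) ≤ ((s + 1 : ℕ) : ℚ) * B := by positivity
      simp only [Pi.zero_apply, Finset.sum_const_zero] at hlt
      linarith
    obtain ⟨c, hc0, hcs, hcw, hcB⟩ := circuit hζ w hw z hz hz0 hzw
    rw [← hB] at hcB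
    have hne : (Finset.univ.filter fun i => c i ≠ 0).Nonempty := by
      obtain ⟨i, hi⟩ := Function.ne_iff.mp hc0
      exact ⟨i, by simpa using hi⟩
    obtain ⟨k, hk, hmin⟩ := Finset.exists_min_image _ (fun i => z i / c i) hne
    simp only [Finset.mem_filter, Finset.mem_univ, true_and] at hk hmin
    set θ := z k / c k with hθ
    have hckpos : (0 : ℚ) < c k := by exact_mod_cast Nat.pos_of_ne_zero hk
    have hθ0 : 0 ≤ θ := div_nonneg (hz k) hckpos.le
    have hle : ∀ i, θ * c i ≤ z i := by
      intro i
      by_cases h : c i = 0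
      · simpa [h] using hz i
      · have : (0 : ℚ) < c i := by exact_mod_cast Nat.pos_of_ne_zero h
        exact (le_div_iff₀ this).mp (hmin i h)
    by_cases h1 : 1 ≤ θ
    · refine ⟨c, hc0, fun i => ?_, hcw, hcB⟩
      refine le_trans ?_ (hle i)
      exact le_mul_of_one_le_left (by positivity) h1
    · push Not at h1
      have hcBq : ((∑ i, c i : ℕ) : ℚ) ≤ B := by exact_mod_cast hcB
      suffices h : ∃ c' : ι → ℕ, c' ≠ 0 ∧ (∀ i, (c' i : ℚ) ≤ z i - θ * c i) ∧
          (∀ j, ∑ i, (c' i : ℤ) * w i j = 0) ∧ ∑ i, c' i ≤ B by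
        obtain ⟨d, hd0, hdz, hdw, hdB⟩ := h
        refine ⟨d, hd0, fun i => (hdz i).trans ?_, hdw, hdB⟩
        have : 0 ≤ θ * c i := by positivity
        linarith
      refine ih (fun i => z i - θ * c i) (fun i => sub_nonneg.mpr (hle i)) ?_ ?_ ?_
      · have hss : (Finset.univ.filter fun i => z i - θ * c i ≠ 0) ⊂
            (Finset.univ.filter fun i => z i ≠ 0) := by
          rw [Finset.ssubset_iff_of_subset]
          · refine ⟨k, by simpa using hcs k hk, ?_⟩
            simp only [Finset.mem_filter, Finset.mem_univ, true_and, not_not]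
            rw [hθ, div_mul_cancel₀ _ hckpos.ne', sub_self]
          · intro i hi
            simp only [Finset.mem_filter, Finset.mem_univ, true_and] at hi ⊢
            intro h
            apply hi
            have hc : c i = 0 := by
              by_contra h'
              exact hcs i h' h
            simp [h, hc]
        have := Finset.card_lt_card hss
        omega
      · intro j
        have h2 : ∑ i, (c i : ℚ) * (w i j : ℚ) = 0 := by exact_mod_cast hcw j
        simp_rw [sub_mul, mul_assoc]
        rw [Finset.sum_sub_distrib, ← Finset.mul_sum, hzw j, h2]
        ring
      · rw [Finset.sum_sub_distrib, ← Finset.mul_sum]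
        push_cast at hlt hcBq
        have : θ * ∑ i, (c i : ℚ) ≤ B := by
          have h0 : 0 ≤ ∑ i, (c i : ℚ) := by positivity
          nlinarith
        linarith

theorem split_gen {κ ζ : ℕ} (hζ : 1 ≤ ζ) {α : Type*} [DecidableEq α] (x : α → Fin κ → ℤ)
    (hx : ∀ i j, |x i j| ≤ (ζ : ℤ)) (U : Finset α)
    (hU : ((2 * ζ + 1) ^ κ + κ) * ((κ + 1) * ((κ + 1) * ζ) ^ κ) < U.card) :
    ∃ S ⊆ U, S ≠ ∅ ∧ S ≠ U ∧ conformal (∑ i ∈ S, x i) (∑ i ∈ U, x i) := by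
  classical
  set B := (κ + 1) * ((κ + 1) * ζ) ^ κ with hB
  let V : Finset (Fin κ → ℤ) := Fintype.piFinset fun _ => Finset.Icc (-(ζ : ℤ)) ζ
  have hxV : ∀ i, x i ∈ V := by
    intro i
    rw [Fintype.mem_piFinset]
    intro j
    rw [Finset.mem_Icc]
    exact abs_le.mp (hx i j)
  have hVcard : V.card = (2 * ζ + 1) ^ κ := by
    rw [Fintype.card_piFinset]
    simp only [Int.card_Icc, Finset.prod_const, Finset.card_univ, Fintype.card_fin]
    congr 1
    omega
  set X : Fin κ → ℤ := ∑ i ∈ U, x i with hX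
  let σ : Fin κ → ℤ := fun j => if 0 ≤ X j then 1 else -1
  have hσX : ∀ j, σ j * |X j| = X j := by
    intro j
    simp only [σ]
    split_ifs with h
    · rw [abs_of_nonneg h, one_mul]
    · rw [abs_of_neg (by omega)]; ring
  have hσabs : ∀ j, |σ j| = 1 := by
    intro j
    simp only [σ]
    split_ifs <;> simp
  let w : (V ⊕ Fin κ) → Fin κ → ℤ :=
    Sum.elim (fun v => v.1) (fun k => fun j => if j = k then -σ k else 0)
  let n : V → ℕ := fun v => (U.filter fun i => x i = v.1).card
  let z : (V ⊕ Fin κ) → ℚ := Sum.elim (fun v => (n v : ℚ)) (fun k => ((|X k| : ℤ) : ℚ))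
  have hw : ∀ i j, |w i j| ≤ (ζ : ℤ) := by
    rintro (v | k) j
    · have := v.2
      rw [Fintype.mem_piFinset] at this
      have := this j
      rw [Finset.mem_Icc] at this
      exact abs_le.mpr this
    · simp only [w, Sum.elim_inr]
      split_ifs
      · rw [abs_neg, hσabs]; exact_mod_cast hζ
      · simp
  have hz : ∀ i, 0 ≤ z i := by
    rintro (v | k)
    · simp [z]
    · simp only [z, Sum.elim_inr]; exact_mod_cast abs_nonneg _
  -- sums over a subset, grouped by type
  have hgroup : ∀ (S : Finset α) (j : Fin κ), ∑ v : V, ((S.filter fun i => x i = v.1).card : ℤ) * v.1 j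
      = (∑ i ∈ S, x i) j := by
    intro S j
    rw [Finset.sum_apply, Finset.sum_coe_sort V (fun v => ((S.filter fun i => x i = v).card : ℤ) * v j),
      ← Finset.sum_fiberwise_of_maps_to (s := S) (t := V) (g := x) (fun i _ => hxV i)]
    refine Finset.sum_congr rfl fun v _ => ?_
    rw [Finset.sum_congr rfl (g := fun _ => v j)]
    · simp
    · intro i hi
      rw [(Finset.mem_filter.mp hi).2]
  have hcardgroup : ∀ (S : Finset α), ∑ v : V, (S.filter fun i => x i = v.1).card = S.card := by
    intro S
    rw [Finset.sum_coe_sort V (fun v => (S.filter fun i => x i = v).card)]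
    exact (Finset.card_eq_sum_card_fiberwise (fun i _ => hxV i)).symm
  have hslack : ∀ (d : Fin κ → ℤ) j, ∑ k, d k * w (Sum.inr k) j = - (σ j * d j) := by
    intro d j
    simp [w, mul_comm]
  have hzw : ∀ j, ∑ i, z i * (w i j : ℚ) = 0 := by
    intro j
    rw [Fintype.sum_sum_type]
    have h1 := hgroup U j
    have h2 := hslack (fun k => |X k|) j
    have h3 : ∑ v : V, (n v : ℤ) * w (Sum.inl v) j + ∑ k, |X k| * w (Sum.inr k) j = 0 := by
      rw [h2, hσX, hX]
      have : ∑ v : V, (n v : ℤ) * w (Sum.inl v) j = (∑ i ∈ U, x i) j := h1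
      rw [this]; ring
    have h4 : ((∑ v : V, (n v : ℤ) * w (Sum.inl v) j + ∑ k, |X k| * w (Sum.inr k) j : ℤ) : ℚ) = 0 := by
      rw [h3]; rfl
    simp only [Int.cast_add, Int.cast_sum, Int.cast_mul, Int.cast_natCast] at h4
    exact h4
  have hlt : (((2 * ζ + 1) ^ κ + κ : ℕ) * B : ℚ) < ∑ i, z i := by
    rw [Fintype.sum_sum_type]
    have h1 : ∑ v : V, z (Sum.inl v) = (U.card : ℚ) := by
      rw [← hcardgroup U]
      simp [z, n]
    have h2 : 0 ≤ ∑ k, z (Sum.inr k) := Finset.sum_nonneg fun k _ => hz _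
    have h3 : (((2 * ζ + 1) ^ κ + κ : ℕ) * B : ℚ) < U.card := by exact_mod_cast hU
    linarith
  obtain ⟨c, hc0, hcz, hcw, hcB⟩ := peel hζ w hw B hB ((2 * ζ + 1) ^ κ + κ) z hz (by
    refine (Finset.card_le_univ _).trans ?_
    simp [hVcard]) hzw hlt
  have hcn : ∀ v : V, c (Sum.inl v) ≤ n v := by
    intro v
    have := hcz (Sum.inl v)
    simp only [z, Sum.elim_inl] at this
    exact_mod_cast this
  have hcX : ∀ k, (c (Sum.inr k) : ℤ) ≤ |X k| := by
    intro v
    have := hcz (Sum.inr v)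
    simp only [z, Sum.elim_inr] at this
    have h' : (((c (Sum.inr v) : ℤ)) : ℚ) ≤ ((|X v| : ℤ) : ℚ) := by simpa using this
    exact Int.cast_le.mp h'
  choose R hRsub hRcard using fun v : V => Finset.exists_subset_card_eq (hcn v)
  let S : Finset α := U.filter fun i => i ∈ R ⟨x i, hxV i⟩
  have hSfib : ∀ v : V, (S.filter fun i => x i = v.1) = R v := by
    intro v
    ext i
    simp only [S, Finset.mem_filter]
    constructor
    · rintro ⟨⟨_, h⟩, h'⟩
      have : (⟨x i, hxV i⟩ : V) = v := Subtype.ext h'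
      rwa [this] at h
    · intro h
      have h2 := Finset.mem_filter.mp (hRsub v h)
      have : (⟨x i, hxV i⟩ : V) = v := Subtype.ext h2.2
      exact ⟨⟨h2.1, by rwa [this]⟩, h2.2⟩
  have hSsum : ∀ j, (∑ i ∈ S, x i) j = σ j * c (Sum.inr j) := by
    intro j
    rw [← hgroup S j]
    have h := hcw j
    rw [Fintype.sum_sum_type, hslack (fun k => (c (Sum.inr k) : ℤ)) j] at h
    have h2 : ∑ v : V, ((S.filter fun i => x i = v.1).card : ℤ) * v.1 j
        = ∑ v : V, (c (Sum.inl v) : ℤ) * w (Sum.inl v) j := by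
      refine Finset.sum_congr rfl fun v _ => ?_
      rw [hSfib, hRcard]
      rfl
    rw [h2]
    linarith
  have hScard : S.card = ∑ v : V, c (Sum.inl v) := by
    rw [← hcardgroup S]
    refine Finset.sum_congr rfl fun v _ => ?_
    rw [hSfib, hRcard]
  refine ⟨S, Finset.filter_subset _ _, ?_, ?_, ?_⟩
  · intro hS
    apply hc0
    rw [hS] at hScard hSsum
    funext i
    rcases i with v | k
    · rw [Finset.card_empty] at hScard
      exact Finset.sum_eq_zero_iff.mp hScard.symm v (Finset.mem_univ _)
    · have h := hSsum k
      simp only [Finset.sum_empty, Pi.zero_apply] at h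
      have h' := congrArg abs h
      rw [abs_mul, hσabs] at h'
      simpa using h'.symm
  · intro hS
    rw [hS] at hScard
    rw [Fintype.sum_sum_type] at hcB
    have h1 : U.card ≤ B := by omega
    have h2 : 1 * B ≤ ((2 * ζ + 1) ^ κ + κ) * B := by
      apply Nat.mul_le_mul_right
      have : 1 ≤ (2 * ζ + 1) ^ κ := Nat.one_le_pow _ _ (by omega)
      omega
    omega
  · intro j
    rw [hSsum]
    constructor
    · rw [abs_mul, hσabs, one_mul, Nat.abs_cast]
      exact hcX j
    · rw [← hσX j]
      have : σ j * c (Sum.inr j) * (σ j * |X j|) = (σ j)^2 * (c (Sum.inr j) * |X j|) := by ring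
      rw [this]
      positivity

theorem split_one_nonneg {ζ : ℕ} {α : Type*} [DecidableEq α] (x : α → ℤ)
    (hx : ∀ i, |x i| ≤ (ζ : ℤ)) (U : Finset α) (hU : 2 * ζ < U.card) (hζ : 1 ≤ ζ)
    (hX : 0 ≤ ∑ i ∈ U, x i) :
    ∃ S ⊆ U, S ≠ ∅ ∧ S ≠ U ∧ 0 ≤ ∑ i ∈ S, x i ∧ ∑ i ∈ S, x i ≤ ∑ i ∈ U, x i := by
  classical
  by_cases hbig : (ζ : ℤ) ≤ ∑ i ∈ U, x i
  · obtain ⟨i, hi, hi0⟩ : ∃ i ∈ U, 0 ≤ x i := by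
      by_contra! h
      have hne : U.Nonempty := Finset.card_pos.mp (by omega)
      have := Finset.sum_neg h hne
      omega
    refine ⟨{i}, by simpa using hi, by simp, ?_, by simpa using hi0, ?_⟩
    · rintro rfl
      simp at hU
      omega
    · have := (abs_le.mp (hx i)).2
      simp
      omega
  push Not at hbig
  -- greedy step
  let good : Finset α → Prop := fun S => S ⊆ U ∧ -(ζ : ℤ) < ∑ i ∈ S, x i ∧ ∑ i ∈ S, x i ≤ ζ
  have step : ∀ S, good S → S ≠ U → ∃ i ∈ U \ S, good (insert i S) := by
    rintro S ⟨hSU, h1, h2⟩ hne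
    have hdne : (U \ S).Nonempty := by
      rw [Finset.sdiff_nonempty]
      exact fun h => hne (Finset.Subset.antisymm hSU h)
    have hsum := Finset.sum_sdiff (f := x) hSU
    have fin : ∀ i ∈ U \ S, -(ζ : ℤ) < x i + ∑ i ∈ S, x i → x i + ∑ i ∈ S, x i ≤ ζ →
        ∃ i ∈ U \ S, good (insert i S) := by
      intro i hi ha hb
      have hi' := Finset.mem_sdiff.mp hi
      refine ⟨i, hi, Finset.insert_subset hi'.1 hSU, ?_⟩
      rw [Finset.sum_insert hi'.2]
      exact ⟨ha, hb⟩
    by_cases hp : ∑ i ∈ S, x i ≤ 0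
    · obtain ⟨i, hi, hi0⟩ : ∃ i ∈ U \ S, 0 ≤ x i := by
        by_contra! h
        have := Finset.sum_neg h hdne
        omega
      have := abs_le.mp (hx i)
      exact fin i hi (by omega) (by omega)
    · by_cases hneg : ∃ i ∈ U \ S, x i < 0
      · obtain ⟨i, hi, hi0⟩ := hneg
        have := abs_le.mp (hx i)
        exact fin i hi (by omega) (by omega)
      · push Not at hneg
        obtain ⟨i, hi⟩ := hdne
        have h3 := Finset.single_le_sum hneg hi
        have h4 := hneg i hi
        exact fin i hi (by omega) (by omega)
  let g : Finset α → Finset α := fun S =>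
    if h : good S ∧ S ≠ U then insert (step S h.1 h.2).choose S else S
  have hgsub : ∀ S, S ⊆ g S := by
    intro S
    simp only [g]
    split_ifs
    · exact Finset.subset_insert _ _
    · exact Finset.Subset.refl _
  have hgood : ∀ k, k ≤ U.card → good (g^[k] ∅) ∧ (g^[k] ∅).card = k := by
    intro k
    induction k with
    | zero =>
      intro _
      refine ⟨⟨by simp, ?_, ?_⟩, by simp⟩ <;> simp <;> omega
    | succ k ih =>
      intro hk
      obtain ⟨h1, h2⟩ := ih (by omega)
      have hne : g^[k] ∅ ≠ U := by
        intro h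
        rw [h] at h2
        omega
      rw [Function.iterate_succ_apply']
      have hg : g (g^[k] ∅) = insert (step _ h1 hne).choose (g^[k] ∅) := by
        simp only [g]
        rw [dif_pos ⟨h1, hne⟩]
      have hs := (step _ h1 hne).choose_spec
      rw [hg]
      refine ⟨hs.2, ?_⟩
      rw [Finset.card_insert_of_notMem (Finset.mem_sdiff.mp hs.1).2, h2]
  have hmono : Monotone fun k => g^[k] (∅ : Finset α) := by
    apply monotone_nat_of_le_succ
    intro k
    rw [Function.iterate_succ_apply']
    exact hgsub _
  have hlt : (Finset.Ioc (-(ζ : ℤ)) ζ).card < (Finset.range U.card).card := by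
    rw [Int.card_Ioc, Finset.card_range]
    omega
  obtain ⟨k, hk, l, hl, hkl, heq⟩ := Finset.exists_ne_map_eq_of_card_lt_of_maps_to hlt
    (f := fun k => ∑ i ∈ g^[k] ∅, x i) (by
      intro k hk
      simp only [Finset.coe_range, Set.mem_Iio] at hk
      have := (hgood k hk.le).1
      simp only [Finset.coe_Ioc, Set.mem_Ioc]
      exact this.2)
  have main : ∀ k l, k < l → l < U.card →
      ∑ i ∈ g^[k] ∅, x i = ∑ i ∈ g^[l] ∅, x i →
      ∃ S ⊆ U, S ≠ ∅ ∧ S ≠ U ∧ 0 ≤ ∑ i ∈ S, x i ∧ ∑ i ∈ S, x i ≤ ∑ i ∈ U, x i := by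
    intro k l hkl hl heq
    obtain ⟨hk1, hk2⟩ := hgood k (by omega)
    obtain ⟨hl1, hl2⟩ := hgood l (by omega)
    have hsub : g^[k] ∅ ⊆ g^[l] ∅ := hmono hkl.le
    have hsum := Finset.sum_sdiff (f := x) hsub
    have hc := Finset.card_sdiff_of_subset hsub
    refine ⟨g^[l] ∅ \ g^[k] ∅, Finset.sdiff_subset.trans hl1.1, ?_, ?_, by omega, by omega⟩
    · intro h
      rw [h, Finset.card_empty] at hc
      omega
    · intro h
      rw [h] at hc
      omega
  rw [Finset.mem_range] at hk hl
  rcases lt_or_gt_of_ne hkl with h | h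
  · exact main k l h hl heq
  · exact main l k h hk heq.symm

theorem split_one {ζ : ℕ} (hζ : 1 ≤ ζ) {α : Type*} [DecidableEq α] (x : α → Fin 1 → ℤ)
    (hx : ∀ i j, |x i j| ≤ (ζ : ℤ)) (U : Finset α) (hU : 2 * ζ < U.card) :
    ∃ S ⊆ U, S ≠ ∅ ∧ S ≠ U ∧ conformal (∑ i ∈ S, x i) (∑ i ∈ U, x i) := by
  rcases le_total 0 (∑ i ∈ U, x i 0) with h | h
  · obtain ⟨S, h1, h2, h3, h4, h5⟩ := split_one_nonneg (fun i => x i 0) (fun i => hx i 0) U hU hζ h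
    refine ⟨S, h1, h2, h3, fun j => ?_⟩
    rw [Subsingleton.elim j 0, Finset.sum_apply, Finset.sum_apply, abs_of_nonneg h4, abs_of_nonneg h]
    exact ⟨h5, mul_nonneg h4 h⟩
  · obtain ⟨S, h1, h2, h3, h4, h5⟩ := split_one_nonneg (fun i => - x i 0)
      (fun i => by rw [abs_neg]; exact hx i 0) U hU hζ
      (by rw [Finset.sum_neg_distrib]; omega)
    rw [Finset.sum_neg_distrib] at h4 h5
    rw [Finset.sum_neg_distrib] at h5
    have h4' : ∑ i ∈ S, x i 0 ≤ 0 := by omega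
    refine ⟨S, h1, h2, h3, fun j => ?_⟩
    rw [Subsingleton.elim j 0, Finset.sum_apply, Finset.sum_apply, abs_of_nonpos h4', abs_of_nonpos h]
    exact ⟨h5, mul_nonneg_of_nonpos_of_nonpos h4' h⟩

theorem bound_aux {κ ζ : ℕ} (hκ : 2 ≤ κ) (hζ : 1 ≤ ζ) :
    ((2 * ζ + 1) ^ κ + κ) * ((κ + 1) * ((κ + 1) * ζ) ^ κ) ≤ (24 * ζ) ^ (κ ^ 2) := by
  have hk : κ + 1 ≤ 2 ^ κ := Nat.lt_two_pow_self
  have h2k : 2 * κ ≤ κ ^ 2 := by nlinarith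
  have h1 : (2 * ζ + 1) ^ κ + κ ≤ (6 * ζ) ^ κ := by
    have ha : (2 * ζ + 1) ^ κ ≤ (3 * ζ) ^ κ := Nat.pow_le_pow_left (by omega) _
    have hb : 1 ≤ (3 * ζ) ^ κ := Nat.one_le_pow _ _ (by omega)
    have hc : (6 * ζ) ^ κ = 2 ^ κ * (3 * ζ) ^ κ := by rw [← mul_pow]; ring_nf
    rw [hc]
    calc (2 * ζ + 1) ^ κ + κ ≤ (3 * ζ) ^ κ + κ * (3 * ζ) ^ κ := by nlinarith
      _ = (κ + 1) * (3 * ζ) ^ κ := by ring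
      _ ≤ _ := Nat.mul_le_mul_right _ hk
  calc ((2 * ζ + 1) ^ κ + κ) * ((κ + 1) * ((κ + 1) * ζ) ^ κ)
      ≤ (6 * ζ) ^ κ * (2 ^ κ * (2 ^ κ * ζ) ^ κ) := by gcongr
    _ = 12 ^ κ * 2 ^ (κ ^ 2) * ζ ^ (2 * κ) := by
        rw [mul_pow, mul_pow, ← pow_mul, show κ * κ = κ ^ 2 by ring, two_mul, pow_add,
          show (12 : ℕ) = 6 * 2 by norm_num, mul_pow]
        ring
    _ ≤ 12 ^ (κ ^ 2) * 2 ^ (κ ^ 2) * ζ ^ (κ ^ 2) := by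
        gcongr
        · norm_num
        · omega
    _ = (24 * ζ) ^ (κ ^ 2) := by
        rw [← mul_pow, ← mul_pow, show 12 * 2 = 24 by norm_num]

theorem split_all {κ ζ : ℕ} (hκ : 1 ≤ κ) (hζ : 1 ≤ ζ) {α : Type*} [DecidableEq α]
    (x : α → Fin κ → ℤ) (hx : ∀ i j, |x i j| ≤ (ζ : ℤ)) (U : Finset α)
    (hU : (24 * ζ) ^ (κ ^ 2) < U.card) :
    ∃ S ⊆ U, S ≠ ∅ ∧ S ≠ U ∧ conformal (∑ i ∈ S, x i) (∑ i ∈ U, x i) := by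
  rcases Nat.lt_or_ge κ 2 with h | h
  · obtain rfl : κ = 1 := by omega
    refine split_one hζ x hx U ?_
    simp at hU
    omega
  · exact split_gen hζ x hx U ((bound_aux h hζ).trans_lt hU)

theorem conformal_trans {κ : ℕ} {a b c : Fin κ → ℤ} (h1 : conformal a b) (h2 : conformal b c) :
    conformal a c := by
  intro i
  obtain ⟨ha, hb⟩ := h1 i
  obtain ⟨hc, hd⟩ := h2 i
  refine ⟨ha.trans hc, ?_⟩
  by_cases h0 : b i = 0
  · rw [h0, abs_zero] at ha
    have : a i = 0 := abs_eq_zero.mp (le_antisymm ha (abs_nonneg _))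
    simp [this]
  · have hpos : 0 < b i * b i := mul_self_pos.mpr h0
    have h3 : 0 ≤ (a i * c i) * (b i * b i) := by
      have := mul_nonneg hb hd
      nlinarith
    exact nonneg_of_mul_nonneg_left h3 hpos

theorem conformal_compl {κ : ℕ} {a b c : Fin κ → ℤ} (h : conformal a c) (hs : b + a = c) :
    conformal b c := by
  intro i
  obtain ⟨ha, hb⟩ := h i
  have hi : b i + a i = c i := congrFun hs i
  have hbi : b i = c i - a i := by omega
  rw [hbi]
  rcases lt_trichotomy (c i) 0 with hc | hc | hc
  · have h2 : a i ≤ 0 := by nlinarith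
    rw [abs_of_nonpos h2, abs_of_neg hc] at ha
    rw [abs_of_neg hc, abs_of_nonpos (by omega)]
    exact ⟨by omega, mul_nonneg_of_nonpos_of_nonpos (by omega) hc.le⟩
  · rw [hc, abs_zero] at ha
    have : a i = 0 := abs_eq_zero.mp (le_antisymm ha (abs_nonneg _))
    simp [this, hc]
  · have h2 : 0 ≤ a i := by nlinarith
    rw [abs_of_nonneg h2, abs_of_pos hc] at ha
    rw [abs_of_pos hc, abs_of_nonneg (by omega)]
    exact ⟨by omega, mul_nonneg (by omega) hc.le⟩

theorem partition_all {κ ζ : ℕ} (hκ : 1 ≤ κ) (hζ : 1 ≤ ζ) {α : Type*} [DecidableEq α]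
    (x : α → Fin κ → ℤ) (hx : ∀ i j, |x i j| ≤ (ζ : ℤ)) (U : Finset α) :
    ∃ P : Finset (Finset α), (∀ A ∈ P, ∀ A' ∈ P, A ≠ A' → Disjoint A A') ∧
      (∀ A ∈ P, A ⊆ U) ∧ (∀ i ∈ U, ∃ A ∈ P, i ∈ A) ∧
      ∀ A ∈ P, A.card ≤ (24 * ζ) ^ (κ ^ 2) ∧ conformal (∑ i ∈ A, x i) (∑ i ∈ U, x i) := by
  classical
  induction U using Finset.strongInduction with
  | H U ih =>
    by_cases hU : (24 * ζ) ^ (κ ^ 2) < U.card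
    · obtain ⟨S, hSU, hS0, hSne, hconf⟩ := split_all hκ hζ x hx U hU
      have hconf' : conformal (∑ i ∈ U \ S, x i) (∑ i ∈ U, x i) :=
        conformal_compl hconf (Finset.sum_sdiff hSU)
      have hss : U \ S ⊂ U :=
        Finset.sdiff_ssubset hSU (Finset.nonempty_iff_ne_empty.mpr hS0)
      obtain ⟨P, hP1, hP2, hP3, hP4⟩ := ih S (lt_of_le_of_ne hSU hSne)
      obtain ⟨Q, hQ1, hQ2, hQ3, hQ4⟩ := ih (U \ S) hss
      have hdis : ∀ A ∈ P, ∀ A' ∈ Q, Disjoint A A' := fun A hA A' hA' =>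
        Finset.disjoint_of_subset_left (hP2 A hA)
          (Finset.disjoint_of_subset_right (hQ2 A' hA') Finset.disjoint_sdiff)
      refine ⟨P ∪ Q, ?_, ?_, ?_, ?_⟩
      · intro A hA A' hA' hne
        rcases Finset.mem_union.mp hA with h | h <;> rcases Finset.mem_union.mp hA' with h' | h'
        · exact hP1 A h A' h' hne
        · exact hdis A h A' h'
        · exact (hdis A' h' A h).symm
        · exact hQ1 A h A' h' hne
      · intro A hA
        rcases Finset.mem_union.mp hA with h | h
        · exact (hP2 A h).trans hSU
        · exact (hQ2 A h).trans Finset.sdiff_subset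
      · intro i hi
        by_cases hiS : i ∈ S
        · obtain ⟨A, hA, h⟩ := hP3 i hiS
          exact ⟨A, Finset.mem_union_left _ hA, h⟩
        · obtain ⟨A, hA, h⟩ := hQ3 i (Finset.mem_sdiff.mpr ⟨hi, hiS⟩)
          exact ⟨A, Finset.mem_union_right _ hA, h⟩
      · intro A hA
        rcases Finset.mem_union.mp hA with h | h
        · exact ⟨(hP4 A h).1, conformal_trans (hP4 A h).2 hconf⟩
        · exact ⟨(hQ4 A h).1, conformal_trans (hQ4 A h).2 hconf'⟩
    · refine ⟨{U}, ?_, ?_, ?_, ?_⟩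
      · intro A hA A' hA' hne
        rw [Finset.mem_singleton] at hA hA'
        exact absurd (hA.trans hA'.symm) hne
      · intro A hA
        rw [Finset.mem_singleton.mp hA]
      · intro i hi
        exact ⟨U, Finset.mem_singleton_self _, hi⟩
      · intro A hA
        rw [Finset.mem_singleton.mp hA]
        exact ⟨by omega, fun i => ⟨le_rfl, mul_self_nonneg _⟩⟩

/-- Merging lemma: vectors `x_1, …, x_m ∈ ℤ^κ` with `‖x_i‖_∞ ≤ ζ` can be partitioned
into subsets of cardinality at most `(c·ζ)^{κ²}` (for an absolute constant `c`) each of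
whose sums is `⊑` the total sum. -/
theorem merging_lemma :
    ∃ c : ℕ, 1 ≤ c ∧ ∀ κ ζ : ℕ, 1 ≤ κ → 1 ≤ ζ →
      ∀ (m : ℕ) (x : Fin m → Fin κ → ℤ), (∀ i j, |x i j| ≤ (ζ : ℤ)) →
      ∃ (m' : ℕ) (T : Fin m' → Finset (Fin m)),
        (∀ j j', j ≠ j' → Disjoint (T j) (T j')) ∧
        (∀ i, ∃ j, i ∈ T j) ∧
        ∀ j, (T j).card ≤ (c * ζ) ^ (κ ^ 2) ∧
          conformal (∑ i ∈ T j, x i) (∑ i, x i) := by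
  refine ⟨24, by norm_num, fun κ ζ hκ hζ m x hx => ?_⟩
  obtain ⟨P, hP1, -, hP3, hP4⟩ := partition_all hκ hζ x hx Finset.univ
  refine ⟨P.card, fun j => (P.equivFin.symm j).1, ?_, ?_, ?_⟩
  · intro j j' hne
    refine hP1 _ (P.equivFin.symm j).2 _ (P.equivFin.symm j').2 fun h => hne ?_
    exact P.equivFin.symm.injective (Subtype.ext h)
  · intro i
    obtain ⟨A, hA, hi⟩ := hP3 i (Finset.mem_univ _)
    exact ⟨P.equivFin ⟨A, hA⟩, by simpa using hi⟩
  · intro j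
    exact hP4 _ (P.equivFin.symm j).2
end

section
/- There exists an absolute constant c ≥ 1 such that the following holds for all integers κ ≥ 1 and ζ ≥ 1. Let x_1, x_2, …, x_m be vectors in Z^κ with ‖x_i‖_∞ ≤ ζ for all i (m ≥ 1), and suppose x = x_1 + … + x_m has all coordinates nonnegative. Then there exists a nonempty subset T ⊆ {1, …, m} with |T| ≤ (c·ζ)^{κ²} such that Σ_{i∈T} x_i ⊑ x and every coordinate of x − Σ_{i∈T} x_i is nonnegative. -/
theorem cse_reduce {ι σ : Type*} [DecidableEq ι] [Fintype σ] (A : Finset ι) (u : ι → σ → ℚ) :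
    ∀ (n : ℕ) (w : ι → ℚ), (∀ i, 0 ≤ w i ∧ w i ≤ 1) →
      (A.filter (fun i => 0 < w i ∧ w i < 1)).card ≤ n →
      ∃ w' : ι → ℚ, (∀ i, 0 ≤ w' i ∧ w' i ≤ 1) ∧
        (∀ s, ∑ i ∈ A, w' i * u i s = ∑ i ∈ A, w i * u i s) ∧
        (A.filter (fun i => 0 < w' i ∧ w' i < 1)).card ≤ Fintype.card σ := by
  intro n
  induction n with
  | zero =>
    intro w hw hn
    exact ⟨w, hw, fun _ => rfl, by omega⟩
  | succ n ih =>
    intro w hw hn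
    set F := A.filter (fun i => 0 < w i ∧ w i < 1) with hF
    by_cases hc : F.card ≤ Fintype.card σ
    · exact ⟨w, hw, fun _ => rfl, hc⟩
    have hdep : ¬ LinearIndependent ℚ (fun i : F => u i) := by
      intro h
      have := h.fintype_card_le_finrank
      simp at this
      omega
    rw [Fintype.not_linearIndependent_iff] at hdep
    obtain ⟨g, hg, ⟨i1, hi1F⟩, hi1⟩ := hdep
    set G : ι → ℚ := fun i => if h : i ∈ F then g ⟨i, h⟩ else 0 with hG
    have hG0 : ∀ i, i ∉ F → G i = 0 := fun i hi => by simp [hG, hi]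
    have hGsum : ∀ s, ∑ i ∈ A, G i * u i s = 0 := by
      intro s
      have h1 : ∑ i ∈ A, G i * u i s = ∑ i ∈ F, G i * u i s := by
        symm
        apply Finset.sum_subset (Finset.filter_subset _ _)
        intro i _ hi
        rw [hG0 i hi, zero_mul]
      rw [h1, ← Finset.sum_coe_sort]
      have h2 := congrFun hg s
      simp only [Finset.sum_apply, Pi.smul_apply, smul_eq_mul, Pi.zero_apply] at h2
      rw [← h2]
      apply Finset.sum_congr rfl
      intro i _
      simp [hG]
    have hGi1 : G i1 ≠ 0 := by simpa [hG, hi1F] using hi1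
    set t : ι → ℚ := fun i => if 0 < G i then (1 - w i) / G i else w i / (- G i) with ht
    obtain ⟨i0, hi0, hmin⟩ := Finset.exists_min_image (F.filter (fun i => G i ≠ 0)) t
      ⟨i1, by simp [hi1F, hGi1]⟩
    rw [Finset.mem_filter] at hi0
    obtain ⟨hi0F, hGi0⟩ := hi0
    have hFm : ∀ i, i ∈ F → 0 < w i ∧ w i < 1 := fun i hi => (Finset.mem_filter.1 hi).2
    have ht0 : 0 ≤ t i0 := by
      have := hFm i0 hi0F
      simp only [ht]
      split_ifs with h
      · exact div_nonneg (by linarith) h.le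
      · exact div_nonneg (by linarith) (by linarith)
    set w2 : ι → ℚ := fun i => w i + t i0 * G i with hw2
    have hb : ∀ i, 0 ≤ w2 i ∧ w2 i ≤ 1 := by
      intro i
      have hwi := hw i
      by_cases hGi : G i = 0
      · simp [hw2, hGi, hwi]
      have hiF : i ∈ F := by
        by_contra h
        exact hGi (hG0 i h)
      have hm := hmin i (Finset.mem_filter.2 ⟨hiF, hGi⟩)
      rcases lt_or_gt_of_ne hGi with h | h
      · have e : t i = w i / (- G i) := by simp [ht, not_lt.2 h.le]
        rw [e, le_div_iff₀ (by linarith)] at hm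
        constructor
        · simp only [hw2]; linarith
        · simp only [hw2]; nlinarith
      · have e : t i = (1 - w i) / G i := by simp [ht, h]
        rw [e, le_div_iff₀ h] at hm
        constructor
        · simp only [hw2]; nlinarith
        · simp only [hw2]; linarith
    have hhit : ¬ (0 < w2 i0 ∧ w2 i0 < 1) := by
      rcases lt_or_gt_of_ne hGi0 with h | h
      · have e : t i0 = w i0 / (- G i0) := by simp [ht, not_lt.2 h.le]
        have : w2 i0 = 0 := by
          simp only [hw2]; rw [e]; field_simp; ring
        rw [this]; simp
      · have e : t i0 = (1 - w i0) / G i0 := by simp [ht, h]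
        have : w2 i0 = 1 := by
          simp only [hw2]; rw [e]; field_simp; ring
        rw [this]; simp
    have hlt : (A.filter (fun i => 0 < w2 i ∧ w2 i < 1)).card < F.card := by
      apply Finset.card_lt_card
      rw [Finset.ssubset_iff_of_subset]
      · exact ⟨i0, hi0F, fun h => hhit (Finset.mem_filter.1 h).2⟩
      · intro i hi
        by_contra h
        have e : w2 i = w i := by simp [hw2, hG0 i h]
        rw [Finset.mem_filter, e] at hi
        exact h (Finset.mem_filter.2 hi)
    obtain ⟨w', h1, h2, h3⟩ := ih w2 hb (by omega)
    refine ⟨w', h1, fun s => ?_, h3⟩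
    rw [h2 s]
    simp only [hw2, add_mul, Finset.sum_add_distrib, mul_assoc]
    rw [← Finset.mul_sum, hGsum s]
    simp

def cseGood {ι : Type*} {κ : ℕ} (v : ι → Fin κ → ℤ) (A : Finset ι) : Prop :=
  ∃ w : ι → ℚ, (∀ i, 0 ≤ w i ∧ w i ≤ 1) ∧ ∑ i ∈ A, w i = ((A.card - κ : ℕ) : ℚ) ∧
    ∀ j, ∑ i ∈ A, w i * (v i j : ℚ) = 0

theorem cse_step {ι : Type*} [DecidableEq ι] {κ : ℕ} (v : ι → Fin κ → ℤ) (A : Finset ι)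
    (hA : A.Nonempty) (h : cseGood v A) : ∃ a ∈ A, cseGood v (A.erase a) := by
  by_cases hk : A.card ≤ κ
  · obtain ⟨a, ha⟩ := hA
    refine ⟨a, ha, fun _ => 0, by simp, ?_, by simp⟩
    have : (A.erase a).card - κ = 0 := by
      have := Finset.card_erase_le (s := A) (a := a)
      omega
    simp [this]
  obtain ⟨w, hw, hs, hv⟩ := h
  obtain ⟨d, hd⟩ : ∃ d, A.card = d + 1 + κ := ⟨A.card - κ - 1, by omega⟩
  have e1 : A.card - κ = d + 1 := by omega
  rw [e1] at hs
  have hd1 : (0 : ℚ) < (d : ℚ) + 1 := by positivity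
  set r : ℚ := d / (d + 1) with hr
  have hr0 : 0 ≤ r := by positivity
  have hr1 : r ≤ 1 := by rw [hr, div_le_one hd1]; linarith
  obtain ⟨w', hb, hsum, hF⟩ := cse_reduce A
    (fun i (s : Option (Fin κ)) => s.elim (1 : ℚ) (fun j => (v i j : ℚ))) _
    (fun i => r * w i)
    (fun i => ⟨mul_nonneg hr0 (hw i).1, mul_le_one₀ hr1 (hw i).1 (hw i).2⟩) le_rfl
  have hs1 : ∑ i ∈ A, w' i = d := by
    have := hsum none
    simp only [Option.elim, mul_one] at this
    rw [this, ← Finset.mul_sum, hs, hr]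
    push_cast
    field_simp
  have hs2 : ∀ j, ∑ i ∈ A, w' i * (v i j : ℚ) = 0 := by
    intro j
    have := hsum (some j)
    simp only [Option.elim, mul_assoc] at this
    rw [this, ← Finset.mul_sum, hv, mul_zero]
  simp only [Fintype.card_option, Fintype.card_fin] at hF
  obtain ⟨a, ha, ha0⟩ : ∃ a ∈ A, w' a = 0 := by
    by_contra hcon
    push Not at hcon
    set F := A.filter (fun i => 0 < w' i ∧ w' i < 1) with hFd
    have h1 : ∑ i ∈ A, (1 - w' i) = κ + 1 := by
      rw [Finset.sum_sub_distrib, hs1]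
      simp [hd]; ring
    have h2 : ∑ i ∈ F, (1 - w' i) = ∑ i ∈ A, (1 - w' i) := by
      apply Finset.sum_subset (Finset.filter_subset _ _)
      intro i hi hiF
      have h3 : 0 < w' i := lt_of_le_of_ne (hb i).1 (Ne.symm (hcon i hi))
      have h4 : ¬ w' i < 1 := fun h => hiF (Finset.mem_filter.2 ⟨hi, h3, h⟩)
      linarith [(hb i).2]
    rcases F.eq_empty_or_nonempty with h | h
    · rw [h, Finset.sum_empty, h1] at h2
      have : (0 : ℚ) ≤ κ := by positivity
      linarith
    · have h3 : ∑ i ∈ F, (1 - w' i) < ∑ i ∈ F, (1 : ℚ) := by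
        apply Finset.sum_lt_sum_of_nonempty h
        intro i hi
        linarith [(Finset.mem_filter.1 hi).2.1]
      rw [h2, h1] at h3
      simp only [Finset.sum_const, nsmul_eq_mul, mul_one] at h3
      have : (F.card : ℚ) ≤ κ + 1 := by exact_mod_cast hF
      linarith
  refine ⟨a, ha, w', hb, ?_, fun j => ?_⟩
  · have e2 : (A.erase a).card - κ = d := by rw [Finset.card_erase_of_mem ha]; omega
    rw [e2, ← hs1]
    exact Finset.sum_erase _ ha0
  · rw [← hs2 j]
    exact Finset.sum_erase _ (by simp [ha0])

theorem cse_bound {ι : Type*} {κ : ℕ} (v : ι → Fin κ → ℤ) (ζ : ℕ)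
    (hv : ∀ i j, |v i j| ≤ (ζ : ℤ)) (A : Finset ι) (h : cseGood v A) (j : Fin κ) :
    |∑ i ∈ A, v i j| ≤ ((κ * ζ : ℕ) : ℤ) := by
  obtain ⟨w, hw, hs, hz⟩ := h
  have h1 : ((∑ i ∈ A, v i j : ℤ) : ℚ) = ∑ i ∈ A, (1 - w i) * (v i j : ℚ) := by
    simp only [sub_mul, Finset.sum_sub_distrib, hz j]
    simp
  have h2 : |((∑ i ∈ A, v i j : ℤ) : ℚ)| ≤ (κ : ℚ) * ζ := by
    rw [h1]
    calc _ ≤ ∑ i ∈ A, |(1 - w i) * (v i j : ℚ)| := Finset.abs_sum_le_sum_abs _ _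
      _ ≤ ∑ i ∈ A, (1 - w i) * (ζ : ℚ) := by
        apply Finset.sum_le_sum
        intro i _
        have h0 : 0 ≤ 1 - w i := by linarith [(hw i).2]
        rw [abs_mul, abs_of_nonneg h0]
        apply mul_le_mul_of_nonneg_left _ h0
        exact_mod_cast hv i j
      _ = ((A.card : ℚ) - ((A.card - κ : ℕ) : ℚ)) * ζ := by
        rw [← Finset.sum_mul, Finset.sum_sub_distrib, hs]; simp
      _ ≤ κ * ζ := by
        apply mul_le_mul_of_nonneg_right _ (by positivity)
        have : A.card ≤ (A.card - κ) + κ := by omega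
        have : (A.card : ℚ) ≤ ((A.card - κ : ℕ) : ℚ) + κ := by exact_mod_cast this
        linarith
  exact_mod_cast h2

theorem cse_chain {ι : Type*} [DecidableEq ι] {κ : ℕ} (v : ι → Fin κ → ℤ) :
    ∀ (n : ℕ) (A : Finset ι), A.card = n → cseGood v A →
      ∃ S : ℕ → Finset ι, (∀ k, S k ⊆ A) ∧ Monotone S ∧
        ∀ k ≤ n, (S k).card = k ∧ cseGood v (S k) := by
  intro n
  induction n with
  | zero =>
    intro A hA hg
    refine ⟨fun _ => A, fun _ => subset_rfl, monotone_const, fun k hk => ⟨?_, hg⟩⟩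
    dsimp only
    omega
  | succ n ih =>
    intro A hA hg
    obtain ⟨a, ha, hga⟩ := cse_step v A (Finset.card_pos.1 (by omega)) hg
    obtain ⟨S, h1, h2, h3⟩ := ih (A.erase a) (by rw [Finset.card_erase_of_mem ha]; omega) hga
    have h4 : ∀ k, S k ⊆ A := fun k => (h1 k).trans (Finset.erase_subset _ _)
    refine ⟨fun k => if k ≤ n then S k else A, ?_, ?_, ?_⟩
    · intro k
      dsimp only
      split_ifs
      · exact h4 k
      · exact subset_rfl
    · intro k l hkl
      dsimp only
      split_ifs with p q q
      · exact h2 hkl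
      · exact h4 k
      · omega
      · exact le_rfl
    · intro k hk
      dsimp only
      split_ifs with p
      · exact h3 k p
      · exact ⟨by omega, hg⟩

theorem cse_zero_sum {ι : Type*} [DecidableEq ι] [Fintype ι] [Nonempty ι] {κ : ℕ}
    (v : ι → Fin κ → ℤ) (ζ : ℕ)
    (hv : ∀ i j, |v i j| ≤ (ζ : ℤ)) (h0 : ∀ j, ∑ i, v i j = 0) :
    ∃ U : Finset ι, U.Nonempty ∧ U.card ≤ (2 * (κ * ζ) + 1) ^ κ ∧ ∀ j, ∑ i ∈ U, v i j = 0 := by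
  set N := (2 * (κ * ζ) + 1) ^ κ with hN
  by_cases hm : Fintype.card ι ≤ N
  · exact ⟨Finset.univ, Finset.univ_nonempty, hm, h0⟩
  have hpos : (0 : ℚ) < Fintype.card ι := by exact_mod_cast Fintype.card_pos
  have hg : cseGood v Finset.univ := by
    refine ⟨fun _ => ((Fintype.card ι - κ : ℕ) : ℚ) / Fintype.card ι, fun i => ⟨by positivity, ?_⟩,
      ?_, fun j => ?_⟩
    · rw [div_le_one hpos]
      exact_mod_cast Nat.sub_le _ _
    · simp only [Finset.sum_const, nsmul_eq_mul, Finset.card_univ]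
      field_simp
    · rw [← Finset.mul_sum]
      have : (∑ i, (v i j : ℚ)) = 0 := by exact_mod_cast h0 j
      rw [this, mul_zero]
  obtain ⟨S, -, hmono, hS⟩ := cse_chain v _ Finset.univ rfl hg
  have hcard : (Fintype.piFinset
      (fun _ : Fin κ => Finset.Icc (-((κ * ζ : ℕ) : ℤ)) ((κ * ζ : ℕ) : ℤ))).card
      < (Finset.range (N + 1)).card := by
    rw [Fintype.card_piFinset]
    simp only [Int.card_Icc, Finset.prod_const, Finset.card_univ, Fintype.card_fin,
      Finset.card_range]
    have : (((κ * ζ : ℕ) : ℤ) + 1 - -((κ * ζ : ℕ) : ℤ)).toNat = 2 * (κ * ζ) + 1 := by omega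
    rw [this]
    omega
  have hle : ∀ k, k < N + 1 → k ≤ (Finset.univ : Finset ι).card := by
    intro k hk
    rw [Finset.card_univ]; omega
  obtain ⟨k, hk, l, hl, hne, heq⟩ := Finset.exists_ne_map_eq_of_card_lt_of_maps_to hcard
    (f := fun k => fun j => ∑ i ∈ S k, v i j) (by
      intro k hk
      have hk' : k < N + 1 := by simpa using hk
      have := (hS k (hle k hk')).2
      simp only [Finset.mem_coe, Fintype.mem_piFinset, Finset.mem_Icc]
      intro j
      exact abs_le.1 (cse_bound v ζ hv _ this j))
  have key : ∀ k l, k < N + 1 → l < N + 1 → k < l →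
      (∀ j, ∑ i ∈ S k, v i j = ∑ i ∈ S l, v i j) → ∃ U : Finset ι, U.Nonempty ∧ U.card ≤ N ∧
        ∀ j, ∑ i ∈ U, v i j = 0 := by
    intro k l hk hl hkl h
    have hsub : S k ⊆ S l := hmono hkl.le
    have hc : (S l \ S k).card = l - k := by
      rw [Finset.card_sdiff_of_subset hsub, (hS k (hle k hk)).1, (hS l (hle l hl)).1]
    refine ⟨S l \ S k, Finset.card_pos.1 (by omega), by omega, fun j => ?_⟩
    have := Finset.sum_sdiff (f := fun i => v i j) hsub
    have := h j
    linarith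
  have hk' : k < N + 1 := by simpa using hk
  have hl' : l < N + 1 := by simpa using hl
  rcases lt_or_gt_of_ne hne with h | h
  · exact key k l hk' hl' h (fun j => congrFun heq j)
  · exact key l k hl' hk' h (fun j => (congrFun heq j).symm)

theorem cse_arith (κ ζ : ℕ) (hκ : 1 ≤ κ) (hζ : 1 ≤ ζ) :
    (2 * (κ * ζ) + 1) ^ κ ≤ (6 * ζ) ^ (κ ^ 2) := by
  rw [pow_two, pow_mul]
  apply Nat.pow_le_pow_left
  have h1 : κ ≤ 2 ^ κ := Nat.lt_two_pow_self.le
  have h2 : 3 * ζ ≤ (3 * ζ) ^ κ := Nat.le_self_pow (by omega) _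
  have h3 : 1 ≤ κ * ζ := Nat.mul_pos hκ hζ
  calc 2 * (κ * ζ) + 1 ≤ κ * (3 * ζ) := by nlinarith
    _ ≤ 2 ^ κ * (3 * ζ) ^ κ := Nat.mul_le_mul h1 h2
    _ = (6 * ζ) ^ κ := by rw [← mul_pow]; congr 1; ring

/-- Conformal subset extraction: if vectors `x_1, …, x_m ∈ ℤ^κ` with `‖x_i‖_∞ ≤ ζ`
sum to a vector `x` with all coordinates nonnegative, then some nonempty subset `T` with
`|T| ≤ (c·ζ)^{κ²}` (for an absolute constant `c`) satisfies `Σ_{i∈T} x_i ⊑ x` and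
`x − Σ_{i∈T} x_i ≥ 0` coordinatewise. -/
theorem conformal_subset_extraction :
    ∃ c : ℕ, 1 ≤ c ∧ ∀ κ ζ : ℕ, 1 ≤ κ → 1 ≤ ζ →
      ∀ m : ℕ, 1 ≤ m → ∀ x : Fin m → Fin κ → ℤ,
      (∀ i j, |x i j| ≤ (ζ : ℤ)) →
      (∀ j, 0 ≤ ∑ i, x i j) →
      ∃ T : Finset (Fin m), T.Nonempty ∧ T.card ≤ (c * ζ) ^ (κ ^ 2) ∧
        conformal (∑ i ∈ T, x i) (∑ i, x i) ∧
        ∀ j, 0 ≤ (∑ i, x i j) - ∑ i ∈ T, x i j := by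
  refine ⟨6, by norm_num, ?_⟩
  intro κ ζ hκ hζ m hm x hx hpos
  let ι := Fin m ⊕ (Σ j : Fin κ, Fin (∑ i, x i j).toNat)
  let v : ι → Fin κ → ℤ := Sum.elim x (fun p j => if p.1 = j then -1 else 0)
  have : Nonempty ι := ⟨Sum.inl ⟨0, hm⟩⟩
  have hv : ∀ i j, |v i j| ≤ (ζ : ℤ) := by
    rintro (i | p) j
    · exact hx i j
    · simp only [v, Sum.elim_inr]
      split_ifs <;> simp <;> omega
  have h0 : ∀ j, ∑ i, v i j = 0 := by
    intro j
    rw [Fintype.sum_sum_type]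
    simp only [v, Sum.elim_inl, Sum.elim_inr]
    rw [Fintype.sum_sigma]
    have e : ∀ a : Fin κ, (∑ _y : Fin (∑ i, x i a).toNat, if a = j then (-1 : ℤ) else 0)
        = if a = j then -(∑ i, x i a) else 0 := by
      intro a
      rw [Finset.sum_const, Finset.card_univ, Fintype.card_fin, nsmul_eq_mul,
        Int.toNat_of_nonneg (hpos a)]
      split_ifs <;> ring
    have e2 := Finset.sum_congr rfl (fun a (_ : a ∈ (Finset.univ : Finset (Fin κ))) => e a)
    rw [Finset.sum_ite_eq' Finset.univ j, if_pos (Finset.mem_univ j)] at e2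
    refine (congrArg (fun z => ∑ i, x i j + z) e2).trans ?_
    ring
  obtain ⟨U, hU, hUc, hUs⟩ := cse_zero_sum v ζ hv h0
  have hsplit : ∀ j, ∑ i ∈ U.toLeft, x i j =
      ((U.toRight.filter (fun p => p.1 = j)).card : ℤ) := by
    intro j
    have h := hUs j
    rw [← Finset.toLeft_disjSum_toRight (u := U), Finset.sum_disjSum] at h
    simp only [v, Sum.elim_inl, Sum.elim_inr] at h
    rw [← Finset.sum_filter] at h
    simp only [Finset.sum_const, nsmul_eq_mul] at h
    linarith
  have hub : ∀ j, ((U.toRight.filter (fun p => p.1 = j)).card : ℤ) ≤ ∑ i, x i j := by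
    intro j
    have h1 : (U.toRight.filter (fun p => p.1 = j)).card ≤ (∑ i, x i j).toNat := by
      calc _ ≤ ((Finset.univ : Finset (Fin (∑ i, x i j).toNat)).map
              (Function.Embedding.sigmaMk (β := fun j => Fin (∑ i, x i j).toNat) j)).card := by
            apply Finset.card_le_card
            rintro ⟨j', y⟩ hp
            obtain rfl : j' = j := (Finset.mem_filter.1 hp).2
            exact Finset.mem_map.2 ⟨y, Finset.mem_univ _, rfl⟩
        _ = _ := by simp
    have := hpos j
    omega
  refine ⟨U.toLeft, ?_, ?_, ?_, ?_⟩
  · by_contra hne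
    rw [Finset.not_nonempty_iff_eq_empty] at hne
    obtain ⟨a, ha⟩ := hU
    rcases a with i | p
    · have : i ∈ U.toLeft := Finset.mem_toLeft.2 ha
      rw [hne] at this
      simp at this
    · have h := hsplit p.1
      rw [hne, Finset.sum_empty] at h
      have h2 : 0 < (U.toRight.filter (fun q => q.1 = p.1)).card :=
        Finset.card_pos.2 ⟨p, Finset.mem_filter.2 ⟨Finset.mem_toRight.2 ha, rfl⟩⟩
      omega
  · exact (Finset.card_toLeft_le.trans hUc).trans (cse_arith κ ζ hκ hζ)
  · intro j
    rw [Finset.sum_apply, Finset.sum_apply]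
    have h1 := hsplit j
    have h2 := hub j
    have h3 : 0 ≤ ∑ i ∈ U.toLeft, x i j := by rw [h1]; positivity
    exact ⟨abs_le_abs_of_nonneg h3 (by linarith), mul_nonneg h3 (hpos j)⟩
  · intro j
    have h1 := hsplit j
    have h2 := hub j
    linarith
end

section
/- Fix an integer n ≥ 1. Let A = (1, −1) (a 1×2 integer matrix), B = (1) (a 1×1 matrix), D = (1, 0) (a 1×2 matrix), and let H_0 be the 3-block n-fold matrix built from A, B, D (so H_0·y = 0, for y = (y^0, y^1, …, y^n) with y^0 ∈ Z and y^i ∈ Z², means y^0 + y^i_1 − y^i_2 = 0 for every 1 ≤ i ≤ n and Σ_{i=1}^n y^i_1 = 0). Define y by y^0 = 1, y^1 = (n−1, n), and y^i = (−1, 0) for 2 ≤ i ≤ n. Then y is an element of the Graver basis G(H_0), i.e., H_0·y = 0, y ≠ 0, and there is no z ≠ 0, z ≠ y with H_0·z = 0 and z ⊑ y; moreover ‖y‖_∞ = n. -/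
theorem ker_iff_aux (n : ℕ) (z : (Fin 1 ⊕ Fin n × Fin 2) → ℤ) :
    (threeBlock n 1 2 1 1 !![1, -1] !![1] !![1, 0]).mulVec z = 0 ↔
    (∑ i : Fin n, z (Sum.inr (i, 0)) = 0) ∧
    ∀ i : Fin n, z (Sum.inl 0) + z (Sum.inr (i, 0)) - z (Sum.inr (i, 1)) = 0 := by
  have h1 : (threeBlock n 1 2 1 1 !![1, -1] !![1] !![1, 0]).mulVec z (Sum.inl 0)
      = ∑ i : Fin n, z (Sum.inr (i, 0)) := by
    simp [Matrix.mulVec, dotProduct, threeBlock, Fintype.sum_prod_type]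
  have h2 : ∀ i : Fin n,
      (threeBlock n 1 2 1 1 !![1, -1] !![1] !![1, 0]).mulVec z (Sum.inr (i, 0))
      = z (Sum.inl 0) + z (Sum.inr (i, 0)) - z (Sum.inr (i, 1)) := by
    intro i
    simp [Matrix.mulVec, dotProduct, threeBlock, Fintype.sum_prod_type, Finset.sum_add_distrib]
    ring
  constructor
  · intro h
    refine ⟨?_, fun i => ?_⟩
    · rw [← h1, h]; rfl
    · rw [← h2, h]; rfl
  · rintro ⟨ha, hb⟩
    funext r
    rcases r with r | ⟨i, r⟩
    · rw [Subsingleton.elim r 0, h1, ha]; rfl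
    · rw [Subsingleton.elim r 0, h2, hb]; rfl

/-- For `A = (1, −1)`, `B = (1)`, `D = (1, 0)`, the vector
`y = (1, (n−1, n), (−1, 0), …, (−1, 0))` is a Graver basis element of the
3-block n-fold matrix `H₀`, and `‖y‖_∞ = n`. -/
theorem graver_lower_bound_threeBlock (n : ℕ) (hn : 1 ≤ n)
    (y : (Fin 1 ⊕ Fin n × Fin 2) → ℤ)
    (hy0 : ∀ j : Fin 1, y (Sum.inl j) = 1)
    (hy1 : ∀ i : Fin n, (i : ℕ) = 0 →
      y (Sum.inr (i, 0)) = (n : ℤ) - 1 ∧ y (Sum.inr (i, 1)) = (n : ℤ))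
    (hyi : ∀ i : Fin n, (i : ℕ) ≠ 0 →
      y (Sum.inr (i, 0)) = -1 ∧ y (Sum.inr (i, 1)) = 0) :
    y ∈ graverBasis (threeBlock n 1 2 1 1 !![1, -1] !![1] !![1, 0]) ∧
    (∀ c, |y c| ≤ (n : ℤ)) ∧ (∃ c, |y c| = (n : ℤ)) := by
  obtain ⟨m, rfl⟩ : ∃ m, n = m + 1 := ⟨n - 1, by omega⟩
  obtain ⟨a0, a1⟩ := hy1 0 rfl
  have hs : ∀ i : Fin m, y (Sum.inr (i.succ, 0)) = -1 ∧ y (Sum.inr (i.succ, 1)) = 0 :=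
    fun i => hyi i.succ (by simp)
  push_cast at a0 a1
  have y0 := hy0 0
  refine ⟨⟨?_, ?_, ?_⟩, ?_, ⟨Sum.inr (0, 1), ?_⟩⟩
  · rw [ker_iff_aux]
    refine ⟨?_, fun i => ?_⟩
    · rw [Fin.sum_univ_succ]
      simp [a0, hs]
    · refine Fin.cases ?_ (fun j => ?_) i
      · rw [y0, a0, a1]; ring
      · rw [y0, (hs j).1, (hs j).2]; ring
  · intro h
    rw [h] at y0
    simp at y0
  · intro z hz hz0 hc
    rw [ker_iff_aux] at hz
    obtain ⟨hsum, hrow⟩ := hz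
    have c1 : ∀ j : Fin m, z (Sum.inr (j.succ, 1)) = 0 := by
      intro j
      have := (hc (Sum.inr (j.succ, 1))).1
      rw [(hs j).2] at this
      simpa using this
    have c0 : ∀ j : Fin m, z (Sum.inr (j.succ, 0)) = - z (Sum.inl 0) := by
      intro j
      have := hrow j.succ
      rw [c1] at this
      linarith
    rw [Fin.sum_univ_succ] at hsum
    simp only [c0, Finset.sum_const, Finset.card_univ, Fintype.card_fin, nsmul_eq_mul] at hsum
    have r0 := hrow 0
    obtain ⟨q1, q2⟩ := hc (Sum.inl 0)
    rw [y0] at q1 q2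
    have q3 : z (Sum.inl 0) = 0 ∨ z (Sum.inl 0) = 1 := by
      rw [abs_one, abs_le] at q1
      omega
    have key : ∀ c, z c = z (Sum.inl 0) * y c := by
      rintro (r | ⟨i, r⟩)
      · rw [Subsingleton.elim r 0, y0, mul_one]
      · refine Fin.cases ?_ (fun j => ?_) i <;> fin_cases r <;> simp only [Fin.zero_eta, Fin.mk_one, Fin.isValue]
        · rw [a0]; linarith
        · rw [a1]; linarith
        · rw [(hs j).1, c0]; ring
        · rw [(hs j).2, c1]; ring
    rcases q3 with q | q
    · exact absurd (funext fun c => by rw [key c, q]; simp) hz0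
    · funext c
      rw [key c, q, one_mul]
  · rintro (r | ⟨i, r⟩)
    · rw [hy0]; simp
    · refine Fin.cases ?_ (fun j => ?_) i <;> fin_cases r <;> simp only [Fin.zero_eta, Fin.mk_one, Fin.isValue]
      · rw [a0, abs_le]; push_cast; constructor <;> linarith
      · rw [a1, abs_le]; push_cast; constructor <;> linarith
      · rw [(hs j).1]; simp
      · rw [(hs j).2]; simp; positivity
  · rw [a1, abs_of_nonneg (by positivity)]; push_cast; rfl
end
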